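/- For any α with 0 < α < 1, the number of α-degenerate, r-rich 3-flats determined by a set of n points in real space is O(n⁴r⁻⁵ + n³r⁻³), where the implied constant depends on α. -/

import Mathlib

/-- height of the segment `e` above `t`. -/
def segH {ι : Type} (x y : ι → ℝ) (s : ι × ι → ℝ) (e : ι × ι) (t : ℝ) : ℝ :=
  y e.1 + s e * (t - x e.1)

lemma affine_sign {a b u t : ℝ} (hut : u < t) (hpos : 0 < a + b * t)
    (hne : ∀ z, u < z → z < t → a + b * z ≠ 0) : 0 ≤ a + b * u := by
  by_contra hneg
  push Not at hneg
  have hb : 0 < b := by nlinarith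
  refine hne (-a / b) ?_ ?_ ?_
  · rw [lt_div_iff₀ hb]; linarith
  · rw [div_lt_iff₀ hb]; linarith
  · field_simp; ring

lemma noncross_bound {ι : Type} [DecidableEq ι] (x y : ι → ℝ) (s : ι × ι → ℝ) (A : Finset ι)
    (E : Finset (ι × ι)) (hx : Set.InjOn x A)
    (hE : ∀ e ∈ E, e.1 ∈ A ∧ e.2 ∈ A ∧ x e.1 < x e.2 ∧ segH x y s e (x e.2) = y e.2)
    (hnc : ∀ e ∈ E, ∀ f ∈ E, e ≠ f → ∀ t, x e.1 < t → t < x e.2 → x f.1 < t → t < x f.2 →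
      segH x y s e t ≠ segH x y s f t)
    (hv : ∀ e ∈ E, ∀ k ∈ A, x e.1 < x k → x k < x e.2 → segH x y s e (x k) ≠ y k) :
    E.card ≤ 3 * A.card := by
  classical
  set h := segH x y s with hh
  have hdiff : ∀ e f t, h e t - h f t =
      (y e.1 - s e * x e.1 - (y f.1 - s f * x f.1)) + (s e - s f) * t := by
    intro e f t; simp only [hh, segH]; ring
  have hcont : ∀ e, Continuous (h e) := by
    intro e; simp only [hh]; unfold segH; fun_prop
  have hsl : ∀ e ∈ E, ∀ f ∈ E, e.1 = f.1 → s e = s f → e = f := by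
    intro e he f hf h1 h2
    by_contra hne
    obtain ⟨-, -, a3, -⟩ := hE e he
    obtain ⟨-, -, b3, -⟩ := hE f hf
    obtain ⟨t, ht1, ht2⟩ := exists_between (lt_min a3 (h1 ▸ b3))
    refine hnc e he f hf hne t ht1 (lt_of_lt_of_le ht2 (min_le_left _ _)) (h1 ▸ ht1)
      (lt_of_lt_of_le ht2 (min_le_right _ _)) ?_
    simp only [hh, segH, h1, h2]
  set T := E.filter (fun e => ∃ f ∈ E, f.1 = e.1 ∧ s e < s f) with hT
  have hTop : (E.filter (fun e => ¬ ∃ f ∈ E, f.1 = e.1 ∧ s e < s f)).card ≤ A.card := by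
    apply Finset.card_le_card_of_injOn (fun e => e.1)
    · intro e he
      exact (hE e (Finset.mem_filter.1 he).1).1
    · intro e he f hf hef
      simp only [Finset.coe_filter, Set.mem_ofPred_eq] at he hf hef
      push Not at he hf
      exact hsl e he.1 f hf.1 hef (le_antisymm (hf.2 e he.1 hef) (he.2 f hf.1 hef.symm))
  have hnx : ∀ e ∈ T, ∃ f ∈ E, f.1 = e.1 ∧ s e < s f ∧
      ∀ g ∈ E, g.1 = e.1 → s e < s g → s f ≤ s g := by
    intro e he
    obtain ⟨heE, f, hf, h1, h2⟩ := Finset.mem_filter.1 he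
    obtain ⟨f, hf, hmin⟩ := Finset.exists_min_image (E.filter (fun f => f.1 = e.1 ∧ s e < s f)) s
      ⟨f, Finset.mem_filter.2 ⟨hf, h1, h2⟩⟩
    rw [Finset.mem_filter] at hf
    exact ⟨f, hf.1, hf.2.1, hf.2.2, fun g hg h1 h2 => hmin g (Finset.mem_filter.2 ⟨hg, h1, h2⟩)⟩
  choose! nx nxE nx1 nxs nxmin using hnx
  have hTE : ∀ e ∈ T, e ∈ E := fun e he => (Finset.mem_filter.1 he).1
  have hlt : ∀ e ∈ T, ∀ t, x e.1 < t → h e t < h (nx e) t := by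
    intro e he t ht
    have := mul_lt_mul_of_pos_right (nxs e he) (sub_pos.2 ht)
    simp only [hh, segH, nx1 e he]; linarith
  have hw : ∀ e ∈ T, ∃ w ∈ A, (x e.1 < x w ∧ x w ≤ x e.2 ∧ x w ≤ x (nx e).2 ∧
      h e (x w) ≤ y w ∧ y w ≤ h (nx e) (x w)) ∧
      ∀ k ∈ A, x e.1 < x k → x k ≤ x e.2 → x k ≤ x (nx e).2 → h e (x k) ≤ y k →
        y k ≤ h (nx e) (x k) → x w ≤ x k := by
    intro e he
    obtain ⟨-, a2, a3, a4⟩ := hE e (hTE e he)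
    obtain ⟨-, b2, b3, b4⟩ := hE _ (nxE e he)
    have hne : (A.filter (fun w => x e.1 < x w ∧ x w ≤ x e.2 ∧ x w ≤ x (nx e).2 ∧
      h e (x w) ≤ y w ∧ y w ≤ h (nx e) (x w))).Nonempty := by
      rw [nx1 e he] at b3
      rcases le_total (x e.2) (x (nx e).2) with hle | hle
      · refine ⟨e.2, Finset.mem_filter.2 ⟨a2, a3, le_rfl, hle, a4.le, ?_⟩⟩
        rw [← a4]; exact (hlt e he _ a3).le
      · refine ⟨(nx e).2, Finset.mem_filter.2 ⟨b2, b3, hle, le_rfl, ?_, b4.ge⟩⟩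
        rw [← b4]; exact (hlt e he _ b3).le
    obtain ⟨w, hw, hmin⟩ := Finset.exists_min_image _ x hne
    rw [Finset.mem_filter] at hw
    exact ⟨w, hw.1, hw.2, fun k hk h1 h2 h3 h4 h5 =>
      hmin k (Finset.mem_filter.2 ⟨hk, h1, h2, h3, h4, h5⟩)⟩
  rcases isEmpty_or_nonempty ι with hι | hι
  · have : E = ∅ := Finset.eq_empty_of_forall_notMem (fun e _ => hι.elim e.1)
    simp [this]
  choose! w wA wP wmin using hw
  -- no edge strictly inside the wedge
  have wedge : ∀ e ∈ T, ∀ g ∈ E, ∀ t, x e.1 < t → t < x (w e) → x g.1 < t → t < x g.2 →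
      h e t < h g t → h g t < h (nx e) t → False := by
    intro e he g hg t h1 h2 h3 h4 h5 h6
    obtain ⟨p1, p2, p3, p4, p5⟩ := wP e he
    obtain ⟨eA, -, -, -⟩ := hE e (hTE e he)
    obtain ⟨gA, -, -, -⟩ := hE g hg
    have key1 : ∀ u, x e.1 ≤ u → x g.1 ≤ u → u < t → h e u ≤ h g u := by
      intro u u1 u2 u3
      have := affine_sign (a := (y g.1 - s g * x g.1 - (y e.1 - s e * x e.1))) (b := s g - s e) u3
        (by rw [← hdiff]; linarith) (by
          intro z z1 z2 hz
          rw [← hdiff] at hz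
          refine hnc g hg e (hTE e he) ?_ z (by linarith) (by linarith) (by linarith)
            (by linarith) (by linarith)
          rintro rfl; linarith)
      rw [← hdiff] at this; linarith
    have key2 : ∀ u, x e.1 ≤ u → x g.1 ≤ u → u < t → h g u ≤ h (nx e) u := by
      intro u u1 u2 u3
      have := affine_sign (a := (y (nx e).1 - s (nx e) * x (nx e).1 - (y g.1 - s g * x g.1)))
        (b := s (nx e) - s g) u3
        (by rw [← hdiff]; linarith) (by
          intro z z1 z2 hz
          rw [← hdiff] at hz
          refine hnc _ (nxE e he) g hg ?_ z (by rw [nx1 e he]; linarith) (by linarith) (by linarith)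
            (by linarith) (by linarith)
          rintro rfl; linarith)
      rw [← hdiff] at this; linarith
    have hee : h e (x e.1) = y e.1 := by simp [hh, segH]
    have hne : h (nx e) (x e.1) = y e.1 := by simp [hh, segH, nx1 e he]
    have hgg : h g (x g.1) = y g.1 := by simp [hh, segH]
    rcases lt_trichotomy (x g.1) (x e.1) with hc | hc | hc
    · refine hv g hg e.1 eA hc (by linarith) ?_
      exact le_antisymm ((key2 _ le_rfl hc.le h1).trans hne.le)
        (hee.ge.trans (key1 _ le_rfl hc.le h1))
    · have hge : g.1 = e.1 := hx gA eA hc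
      have hs1 : s e < s g := by
        simp only [hh, segH, hge] at h5
        by_contra hcon
        push Not at hcon
        nlinarith
      have hs2 := nxmin e he g hg hge hs1
      simp only [hh, segH, hge, nx1 e he] at h6
      nlinarith
    · have := wmin e he g.1 gA hc (by linarith) (by linarith)
        (by rw [← hgg]; exact key1 _ hc.le le_rfl h3) (by rw [← hgg]; exact key2 _ hc.le le_rfl h3)
      linarith
  -- injectivity
  have inj : ∀ e ∈ T, ∀ f ∈ T, w e = w f → h e (x (w e)) < h (nx f) (x (w e)) →
      h f (x (w e)) < h (nx e) (x (w e)) → e = f := by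
    intro e he f hf hwe h1 h2
    by_contra hne
    obtain ⟨p1, p2, p3, p4, p5⟩ := wP e he
    obtain ⟨q1, q2, q3, q4, q5⟩ := wP f hf
    rw [← hwe] at q1 q2 q3 q4 q5
    have ev1 : ∀ᶠ t in nhdsWithin (x (w e)) (Set.Iio (x (w e))), h e t < h (nx f) t :=
      nhdsWithin_le_nhds ((hcont e).continuousAt.eventually_lt (hcont _).continuousAt h1)
    have ev2 : ∀ᶠ t in nhdsWithin (x (w e)) (Set.Iio (x (w e))), h f t < h (nx e) t :=
      nhdsWithin_le_nhds ((hcont f).continuousAt.eventually_lt (hcont _).continuousAt h2)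
    have ev3 : ∀ᶠ t in nhdsWithin (x (w e)) (Set.Iio (x (w e))), x e.1 < t :=
      nhdsWithin_le_nhds (lt_mem_nhds p1)
    have ev4 : ∀ᶠ t in nhdsWithin (x (w e)) (Set.Iio (x (w e))), x f.1 < t :=
      nhdsWithin_le_nhds (lt_mem_nhds q1)
    have ev5 : ∀ᶠ t in nhdsWithin (x (w e)) (Set.Iio (x (w e))), t < x (w e) :=
      self_mem_nhdsWithin
    obtain ⟨t, t1, t2, t3, t4, t5⟩ := (ev1.and (ev2.and (ev3.and (ev4.and ev5)))).exists
    rcases lt_trichotomy (h e t) (h f t) with hc | hc | hc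
    · exact wedge e he f (hTE f hf) t t3 t5 t4 (by linarith) hc t2
    · exact hnc e (hTE e he) f (hTE f hf) hne t t3 (by linarith) t4 (by linarith) hc
    · exact wedge f hf e (hTE e he) t t4 (hwe ▸ t5) t3 (by linarith) hc t1
  have cA : (T.filter (fun e => y (w e) < h (nx e) (x (w e)))).card ≤ A.card := by
    apply Finset.card_le_card_of_injOn w
    · intro e he
      exact wA e (Finset.mem_filter.1 he).1
    · intro e he f hf hef
      simp only [Finset.coe_filter, Set.mem_ofPred_eq] at he hf
      have a1 := (wP e he.1).2.2.2.1
      have a2 := (wP f hf.1).2.2.2.1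
      refine inj e he.1 f hf.1 hef ?_ ?_
      · refine lt_of_le_of_lt a1 ?_
        rw [hef]; exact hf.2
      · have := lt_of_le_of_lt a2 (hef ▸ he.2)
        rw [hef]; exact this
  have cB : (T.filter (fun e => ¬ y (w e) < h (nx e) (x (w e)))).card ≤ A.card := by
    apply Finset.card_le_card_of_injOn w
    · intro e he
      exact wA e (Finset.mem_filter.1 he).1
    · intro e he f hf hef
      simp only [Finset.coe_filter, Set.mem_ofPred_eq, not_lt] at he hf
      have a1 := hlt e he.1 _ (wP e he.1).1
      have a2 := hlt f hf.1 _ (wP f hf.1).1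
      have a3 := (wP e he.1).2.2.2.2
      have a4 := (wP f hf.1).2.2.2.2
      have a5 := he.2
      have a6 := hf.2
      rw [← hef] at a2 a4 a6
      exact inj e he.1 f hf.1 hef (by linarith) (by linarith)
  have e1 := Finset.card_filter_add_card_filter_not (s := E) (fun e => ∃ f ∈ E, f.1 = e.1 ∧ s e < s f)
  have e2 := Finset.card_filter_add_card_filter_not (s := T) (fun e => y (w e) < h (nx e) (x (w e)))
  rw [← hT] at e1
  omega

def CrossP {ι : Type} (x y : ι → ℝ) (s : ι × ι → ℝ) (e f : ι × ι) : Prop :=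
  e ≠ f ∧ ∃ t, x e.1 < t ∧ t < x e.2 ∧ x f.1 < t ∧ t < x f.2 ∧ segH x y s e t = segH x y s f t

open Classical in
lemma cross_bound {ι : Type} (x y : ι → ℝ) (s : ι × ι → ℝ) (A : Finset ι)
    (hx : Set.InjOn x A) (E : Finset (ι × ι))
    (hE : ∀ e ∈ E, e.1 ∈ A ∧ e.2 ∈ A ∧ x e.1 < x e.2 ∧ segH x y s e (x e.2) = y e.2)
    (hv : ∀ e ∈ E, ∀ k ∈ A, x e.1 < x k → x k < x e.2 → segH x y s e (x k) ≠ y k) :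
    E.card ≤ 3 * A.card + ((E ×ˢ E).filter (fun p => CrossP x y s p.1 p.2)).card := by
  induction E using Finset.strongInduction with
  | H E ih =>
    by_cases hc : ∃ e ∈ E, ∃ f ∈ E, CrossP x y s e f
    · obtain ⟨e, he, f, hf, hef⟩ := hc
      have h1 := ih (E.erase e) (Finset.erase_ssubset he)
        (fun e' h' => hE e' (Finset.mem_of_mem_erase h'))
        (fun e' h' => hv e' (Finset.mem_of_mem_erase h'))
      have h2 : (((E.erase e) ×ˢ (E.erase e)).filter (fun p => CrossP x y s p.1 p.2)).card <
          ((E ×ˢ E).filter (fun p => CrossP x y s p.1 p.2)).card := by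
        apply Finset.card_lt_card
        rw [Finset.ssubset_iff_of_subset]
        · exact ⟨(e, f), by simp [he, hf, hef], by simp⟩
        · intro p hp
          simp only [Finset.mem_filter, Finset.mem_product, Finset.mem_erase] at hp ⊢
          tauto
      have h3 := Finset.card_erase_add_one he
      omega
    · push Not at hc
      have := noncross_bound x y s A E hx hE (fun e he f hf hne t h1 h2 h3 h4 h5 =>
        hc e he f hf ⟨hne, t, h1, h2, h3, h4, h5⟩) hv
      omega

lemma count_zero {ι : Type} [Fintype ι] [DecidableEq ι] (k : ℕ) (T : Finset ι) :
    (k + 1) ^ T.card * (Finset.univ.filter (fun f : ι → Fin (k + 1) => ∀ i ∈ T, f i = 0)).card =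
      (k + 1) ^ (Fintype.card ι) := by
  have : (Finset.univ.filter (fun f : ι → Fin (k + 1) => ∀ i ∈ T, f i = 0)) =
      Fintype.piFinset (fun i => if i ∈ T then ({0} : Finset (Fin (k+1))) else Finset.univ) := by
    ext f
    simp only [Finset.mem_filter, Finset.mem_univ, true_and, Fintype.mem_piFinset]
    refine forall_congr' fun i => ?_
    by_cases hi : i ∈ T <;> simp [hi]
  rw [this, Fintype.card_piFinset]
  have h2 : ∀ i, (if i ∈ T then ({0} : Finset (Fin (k+1))) else Finset.univ).card =
      if i ∈ T then 1 else (k + 1) := by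
    intro i; by_cases hi : i ∈ T <;> simp [hi]
  simp only [h2]
  have h3 : (k + 1) ^ T.card = ∏ i : ι, if i ∈ T then (k + 1) else 1 := by
    simp
  rw [h3, ← Finset.prod_mul_distrib]
  have : ∀ i : ι, ((if i ∈ T then (k + 1) else 1) * if i ∈ T then 1 else (k + 1)) = k + 1 := by
    intro i; split_ifs <;> simp
  simp [this]

open Classical in
lemma amplify {ι : Type} [Fintype ι] (x y : ι → ℝ) (s : ι × ι → ℝ)
    (hx : Function.Injective x) (E : Finset (ι × ι))
    (hE : ∀ e ∈ E, x e.1 < x e.2 ∧ segH x y s e (x e.2) = y e.2)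
    (hv : ∀ e ∈ E, ∀ k, x e.1 < x k → x k < x e.2 → segH x y s e (x k) ≠ y k)
    (h4 : ∀ e ∈ E, ∀ f ∈ E, CrossP x y s e f → ({e.1, e.2, f.1, f.2} : Finset ι).card = 4)
    (k : ℕ) :
    E.card * (k + 1) ^ 2 ≤ 3 * Fintype.card ι * (k + 1) ^ 3 +
      ((E ×ˢ E).filter (fun p => CrossP x y s p.1 p.2)).card := by
  set X := (E ×ˢ E).filter (fun p => CrossP x y s p.1 p.2) with hX
  set F := (Finset.univ : Finset (ι → Fin (k + 1))) with hF
  have main : ∀ f : ι → Fin (k + 1), (E.filter (fun e => f e.1 = 0 ∧ f e.2 = 0)).card ≤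
      3 * (Finset.univ.filter (fun i => f i = 0)).card +
      (X.filter (fun p => f p.1.1 = 0 ∧ f p.1.2 = 0 ∧ f p.2.1 = 0 ∧ f p.2.2 = 0)).card := by
    intro f
    refine (cross_bound x y s (Finset.univ.filter (fun i => f i = 0)) hx.injOn
      (E.filter (fun e => f e.1 = 0 ∧ f e.2 = 0)) ?_ ?_).trans ?_
    · intro e he
      rw [Finset.mem_filter] at he
      simp only [Finset.mem_filter, Finset.mem_univ, true_and]
      exact ⟨he.2.1, he.2.2, hE e he.1⟩
    · intro e he j _ 
      rw [Finset.mem_filter] at he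
      exact hv e he.1 j
    · gcongr
      intro p hp
      simp only [hX, Finset.mem_filter, Finset.mem_product] at hp ⊢
      tauto
  have sum := Finset.sum_le_sum (s := F) (fun f _ => main f)
  rw [Finset.sum_add_distrib, ← Finset.mul_sum] at sum
  have s1 : ∑ f ∈ F, (E.filter (fun e => f e.1 = 0 ∧ f e.2 = 0)).card =
      ∑ e ∈ E, (F.filter (fun f => f e.1 = 0 ∧ f e.2 = 0)).card := by
    simp only [Finset.card_filter]; exact Finset.sum_comm
  have s2 : ∑ f ∈ F, ((Finset.univ : Finset ι).filter (fun i => f i = 0)).card =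
      ∑ i : ι, (F.filter (fun f => f i = 0)).card := by
    simp only [Finset.card_filter]; exact Finset.sum_comm
  have s3 : ∑ f ∈ F, (X.filter (fun p => f p.1.1 = 0 ∧ f p.1.2 = 0 ∧ f p.2.1 = 0 ∧ f p.2.2 = 0)).card =
      ∑ p ∈ X, (F.filter (fun f => f p.1.1 = 0 ∧ f p.1.2 = 0 ∧ f p.2.1 = 0 ∧ f p.2.2 = 0)).card := by
    simp only [Finset.card_filter]; exact Finset.sum_comm
  rw [s1, s2, s3] at sum
  have c1 : ∀ e ∈ E, (k + 1) ^ 2 * (F.filter (fun f => f e.1 = 0 ∧ f e.2 = 0)).card =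
      (k + 1) ^ (Fintype.card ι) := by
    intro e he
    have hne : e.1 ≠ e.2 := fun h => by
      have := (hE e he).1; rw [h] at this; exact lt_irrefl _ this
    rw [← count_zero k ({e.1, e.2} : Finset ι), Finset.card_pair hne]
    simp [hF]
  have c2 : ∀ i : ι, (k + 1) * (F.filter (fun f => f i = 0)).card =
      (k + 1) ^ (Fintype.card ι) := by
    intro i
    rw [← count_zero k ({i} : Finset ι)]
    simp [hF]
  have c3 : ∀ p ∈ X, (k + 1) ^ 4 *
      (F.filter (fun f => f p.1.1 = 0 ∧ f p.1.2 = 0 ∧ f p.2.1 = 0 ∧ f p.2.2 = 0)).card =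
      (k + 1) ^ (Fintype.card ι) := by
    intro p hp
    simp only [hX, Finset.mem_filter, Finset.mem_product] at hp
    have := h4 p.1 hp.1.1 p.2 hp.1.2 hp.2
    rw [← count_zero k ({p.1.1, p.1.2, p.2.1, p.2.2} : Finset ι), this]
    simp [hF]
  have t1 : (k + 1) ^ 2 * ∑ e ∈ E, (F.filter (fun f => f e.1 = 0 ∧ f e.2 = 0)).card =
      E.card * (k + 1) ^ (Fintype.card ι) := by
    rw [Finset.mul_sum, Finset.sum_congr rfl c1]; simp
  have t2 : (k + 1) * ∑ i : ι, (F.filter (fun f => f i = 0)).card =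
      Fintype.card ι * (k + 1) ^ (Fintype.card ι) := by
    rw [Finset.mul_sum, Finset.sum_congr rfl (fun i _ => c2 i)]; simp
  have t3 : (k + 1) ^ 4 * ∑ p ∈ X,
      (F.filter (fun f => f p.1.1 = 0 ∧ f p.1.2 = 0 ∧ f p.2.1 = 0 ∧ f p.2.2 = 0)).card =
      X.card * (k + 1) ^ (Fintype.card ι) := by
    rw [Finset.mul_sum, Finset.sum_congr rfl c3]; simp
  have fin := Nat.mul_le_mul_left ((k + 1) ^ 4) sum
  refine Nat.le_of_mul_le_mul_right (c := (k + 1) ^ (Fintype.card ι)) ?_ (by positivity)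
  calc E.card * (k + 1) ^ 2 * (k + 1) ^ (Fintype.card ι)
      = (k + 1) ^ 4 * ∑ e ∈ E, (F.filter (fun f => f e.1 = 0 ∧ f e.2 = 0)).card := by
        rw [mul_right_comm, ← t1]; ring
    _ ≤ _ := fin
    _ = 3 * (k + 1) ^ 3 * ((k + 1) * ∑ i : ι, (F.filter (fun f => f i = 0)).card) +
        (k + 1) ^ 4 * ∑ p ∈ X,
      (F.filter (fun f => f p.1.1 = 0 ∧ f p.1.2 = 0 ∧ f p.2.1 = 0 ∧ f p.2.2 = 0)).card := by ring
    _ = _ := by rw [t2, t3]; ring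

lemma st_numeric (n m r : ℕ) (hr : 2 ≤ r)
    (H : ∀ k : ℕ, m * (r - 1) * (k + 1) ^ 2 ≤ 3 * n * (k + 1) ^ 3 + m * m) :
    (m : ℝ) * r ^ 3 ≤ 2304 * ((n : ℝ) ^ 2 + n * r ^ 2) := by
  rcases Nat.eq_zero_or_pos m with rfl | hm
  · simp; positivity
  have hm' : (0 : ℝ) < m := by exact_mod_cast hm
  have hr' : (2 : ℝ) ≤ r := by exact_mod_cast hr
  have hn' : (0 : ℝ) ≤ n := by positivity
  have H' : ∀ k : ℕ, 4 * (m : ℝ) ≤ r * (k + 1) ^ 2 → (m : ℝ) * r ≤ 12 * n * (k + 1) := by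
    intro k hk
    have h := H k
    have h2 : (m : ℝ) * (r - 1) * (k + 1) ^ 2 ≤ 3 * n * (k + 1) ^ 3 + m * m := by
      have h3 : ((m * (r - 1) * (k + 1) ^ 2 : ℕ) : ℝ) ≤ ((3 * n * (k + 1) ^ 3 + m * m : ℕ) : ℝ) := by
        exact_mod_cast h
      push_cast [Nat.cast_sub (by omega : 1 ≤ r)] at h3
      exact h3
    have hk0 : (0 : ℝ) < (k + 1 : ℝ) ^ 2 := by positivity
    have h3 : (m : ℝ) * (r / 2) * (k + 1) ^ 2 ≤ m * (r - 1) * (k + 1) ^ 2 := by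
      gcongr; linarith
    have h4 : (m : ℝ) * (4 * m) ≤ m * (r * (k + 1) ^ 2) := by gcongr
    have h5 : ((m : ℝ) * r) * (k + 1) ^ 2 ≤ (12 * n * (k + 1)) * (k + 1) ^ 2 := by nlinarith
    exact le_of_mul_le_mul_right h5 hk0
  by_cases hc : 4 * (m : ℝ) ≤ r
  · have := H' 0 (by simpa using hc)
    simp at this
    nlinarith [mul_le_mul_of_nonneg_right this (sq_nonneg (r : ℝ)), sq_nonneg (n : ℝ)]
  · push Not at hc
    set q := Real.sqrt (4 * m / r) with hq
    have hq2 : q ^ 2 = 4 * m / r := Real.sq_sqrt (by positivity)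
    have hq1 : 1 ≤ q := by
      rw [hq]; apply Real.one_le_sqrt.2
      rw [le_div_iff₀ (by linarith)]; linarith
    set k := ⌊q⌋₊
    have k1 : (k : ℝ) ≤ q := Nat.floor_le (by linarith)
    have k2 : q < k + 1 := Nat.lt_floor_add_one q
    have h1 := H' k (by
      have : q ^ 2 ≤ (k + 1 : ℝ) ^ 2 := by gcongr
      rw [hq2, div_le_iff₀ (by linarith)] at this
      linarith)
    have h2 : (m : ℝ) * r ≤ 24 * n * q := by nlinarith
    have h3 : ((m : ℝ) * r) ^ 2 ≤ (24 * n * q) ^ 2 := by gcongr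
    have h4 : (24 * n * q) ^ 2 = 2304 * n ^ 2 * m / r := by
      rw [mul_pow, hq2]; ring
    rw [h4, le_div_iff₀ (by linarith)] at h3
    have h5 : (m : ℝ) * (m * r ^ 3) ≤ m * (2304 * n ^ 2) := by nlinarith
    have h6 := le_of_mul_le_mul_left h5 hm'
    nlinarith [mul_nonneg hn' (sq_nonneg (r : ℝ))]

open Classical in
lemma st_plane {ι : Type} [Fintype ι] (x y : ι → ℝ) (hx : Function.Injective x)
    (L : Finset (ℝ × ℝ)) (r : ℕ) (hr : 2 ≤ r)
    (hL : ∀ l ∈ L, r ≤ (Finset.univ.filter (fun i => y i = l.1 * x i + l.2)).card) :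
    (L.card : ℝ) * r ^ 3 ≤ 2304 * ((Fintype.card ι : ℝ) ^ 2 + Fintype.card ι * r ^ 2) := by
  apply st_numeric _ _ _ hr
  intro k
  set s : ι × ι → ℝ := fun e => (y e.2 - y e.1) / (x e.2 - x e.1) with hs
  set edg : ℝ × ℝ → Finset (ι × ι) := fun l => Finset.univ.filter (fun e =>
    y e.1 = l.1 * x e.1 + l.2 ∧ y e.2 = l.1 * x e.2 + l.2 ∧ x e.1 < x e.2 ∧
    ∀ j, y j = l.1 * x j + l.2 → x e.1 < x j → x e.2 ≤ x j) with hedg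
  have memE : ∀ l e, e ∈ edg l ↔ (y e.1 = l.1 * x e.1 + l.2 ∧ y e.2 = l.1 * x e.2 + l.2 ∧
    x e.1 < x e.2 ∧ ∀ j, y j = l.1 * x j + l.2 → x e.1 < x j → x e.2 ≤ x j) := by
    intro l e; simp [hedg]
  have hseg : ∀ l, ∀ e ∈ edg l, ∀ t, segH x y s e t = l.1 * t + l.2 := by
    intro l e he t
    rw [memE] at he
    obtain ⟨a1, a2, a3, -⟩ := he
    have : x e.2 - x e.1 ≠ 0 := by linarith
    simp only [segH, hs, a1, a2]
    field_simp
    ring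
  have huniq : ∀ l l' : ℝ × ℝ, ∀ u v : ℝ, u ≠ v → l.1 * u + l.2 = l'.1 * u + l'.2 →
      l.1 * v + l.2 = l'.1 * v + l'.2 → l = l' := by
    intro l l' u v huv h1 h2
    have h3 : (l.1 - l'.1) * (u - v) = 0 := by linarith
    have h4 : l.1 = l'.1 := by
      rcases mul_eq_zero.1 h3 with h | h
      · linarith
      · exact absurd (by linarith) huv
    ext
    · exact h4
    · rw [h4] at h1; linarith
  have hcard : ∀ l ∈ L, r - 1 ≤ (edg l).card := by
    intro l hl
    set Q := Finset.univ.filter (fun i => y i = l.1 * x i + l.2) with hQ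
    have hQr : r ≤ Q.card := by convert hL l hl
    have hne : Q.Nonempty := Finset.card_pos.1 (by omega)
    obtain ⟨mx, hmx, hmax⟩ := Finset.exists_max_image Q x hne
    have hsucc : ∀ i ∈ Q.erase mx, ∃ j, (i, j) ∈ edg l := by
      intro i hi
      obtain ⟨hi1, hi2⟩ := Finset.mem_erase.1 hi
      have hlt : x i < x mx := lt_of_le_of_ne (hmax i hi2) (fun h => hi1 (hx h))
      obtain ⟨j, hj, hmin⟩ := Finset.exists_min_image (Q.filter (fun j => x i < x j)) x
        ⟨mx, Finset.mem_filter.2 ⟨hmx, hlt⟩⟩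
      simp only [hQ, Finset.mem_filter, Finset.mem_univ, true_and] at hj hi2 hmin
      exact ⟨j, (memE _ _).2 ⟨hi2, hj.1, hj.2, fun j' h1 h2 => hmin j' ⟨h1, h2⟩⟩⟩
    have : Q.erase mx ⊆ (edg l).image Prod.fst := by
      intro i hi
      obtain ⟨j, hj⟩ := hsucc i hi
      exact Finset.mem_image.2 ⟨_, hj, rfl⟩
    have h1 := (Finset.card_le_card this).trans Finset.card_image_le
    rw [Finset.card_erase_of_mem hmx] at h1
    omega
  have hdisj : (L : Set (ℝ × ℝ)).PairwiseDisjoint edg := by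
    intro l _ l' _ hne
    rw [Function.onFun, Finset.disjoint_left]
    intro e he he'
    rw [memE] at he he'
    exact hne (huniq l l' (x e.1) (x e.2) he.2.2.1.ne (by rw [← he.1, ← he'.1])
      (by rw [← he.2.1, ← he'.2.1]))
  set E := L.biUnion edg with hEdef
  have hEc : L.card * (r - 1) ≤ E.card := by
    rw [hEdef, Finset.card_biUnion hdisj]
    simpa using Finset.card_nsmul_le_sum L (fun l => (edg l).card) (r - 1) hcard
  have hline : ∀ e ∈ E, ∃ l ∈ L, e ∈ edg l := fun e he => by simpa [hEdef] using he
  have same : ∀ l, ∀ e ∈ edg l, ∀ f ∈ edg l, ∀ t, x e.1 < t → t < x e.2 → x f.1 < t → t < x f.2 →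
      e = f := by
    intro l e he f hf t h1 h2 h3 h4
    rw [memE] at he hf
    obtain ⟨a1, a2, a3, a4⟩ := he
    obtain ⟨b1, b2, b3, b4⟩ := hf
    have e1 : x e.1 = x f.1 := by
      rcases lt_trichotomy (x e.1) (x f.1) with h | h | h
      · have := a4 _ b1 h; linarith
      · exact h
      · have := b4 _ a1 h; linarith
    have e2 : x e.2 = x f.2 := le_antisymm (a4 _ b2 (by linarith)) (b4 _ a2 (by linarith))
    exact Prod.ext (hx e1) (hx e2)
  -- crossing edges lie on different lines
  have hcr : ∀ l, ∀ e ∈ edg l, ∀ l', ∀ f ∈ edg l', CrossP x y s e f → l ≠ l' := by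
    rintro l e he l' f hf ⟨hne, t, h1, h2, h3, h4, h5⟩ rfl
    exact hne (same l e he f hf t h1 h2 h3 h4)
  have amp := amplify x y s hx E (by
      intro e he
      obtain ⟨l, hl, he⟩ := hline e he
      have h1 := hseg l e he
      rw [memE] at he
      exact ⟨he.2.2.1, by rw [h1, he.2.1]⟩) (by
      intro e he j h1 h2 h3
      obtain ⟨l, hl, he⟩ := hline e he
      rw [hseg l e he] at h3
      rw [memE] at he
      have := he.2.2.2 j h3.symm h1
      linarith) (by
      intro e he f hf hc
      obtain ⟨l, hl, he⟩ := hline e he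
      obtain ⟨l', hl', hf⟩ := hline f hf
      have hll := hcr l e he l' f hf hc
      obtain ⟨hne, t, h1, h2, h3, h4, h5⟩ := hc
      rw [hseg l e he, hseg l' f hf] at h5
      rw [memE] at he hf
      obtain ⟨a1, a2, a3, a4⟩ := he
      obtain ⟨b1, b2, b3, b4⟩ := hf
      have n1 : e.1 ≠ e.2 := fun h => by rw [h] at a3; exact lt_irrefl _ a3
      have n2 : f.1 ≠ f.2 := fun h => by rw [h] at b3; exact lt_irrefl _ b3
      have no : ∀ j, y j = l.1 * x j + l.2 → y j = l'.1 * x j + l'.2 → x j ≠ t → False := by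
        intro j j1 j2 j3
        exact hll (huniq l l' (x j) t j3 (by rw [← j1, ← j2]) h5)
      have n3 : e.1 ≠ f.1 := fun h => no e.1 a1 (h ▸ b1) h1.ne
      have n4 : e.1 ≠ f.2 := fun h => no e.1 a1 (h ▸ b2) h1.ne
      have n5 : e.2 ≠ f.1 := fun h => no e.2 a2 (h ▸ b1) h2.ne'
      have n6 : e.2 ≠ f.2 := fun h => no e.2 a2 (h ▸ b2) h2.ne'
      rw [Finset.card_insert_of_notMem (by simp [n1, n3, n4]),
        Finset.card_insert_of_notMem (by simp [n5, n6]), Finset.card_pair n2]) k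
  have hX : ((E ×ˢ E).filter (fun p => CrossP x y s p.1 p.2)).card ≤ L.card * L.card := by
    rw [← Finset.card_product]
    choose! lo loL loE using hline
    apply Finset.card_le_card_of_injOn (fun p => (lo p.1, lo p.2))
    · intro p hp
      simp only [Finset.coe_filter, Set.mem_ofPred_eq, Finset.mem_product] at hp
      exact Finset.mem_coe.2 (Finset.mem_product.2 ⟨loL _ hp.1.1, loL _ hp.1.2⟩)
    · intro p hp q hq hpq
      simp only [Finset.coe_filter, Set.mem_ofPred_eq, Finset.mem_product] at hp hq
      simp only [Prod.mk.injEq] at hpq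
      obtain ⟨⟨p1, p2⟩, pc⟩ := hp
      obtain ⟨⟨q1, q2⟩, qc⟩ := hq
      have hll := hcr _ _ (loE _ p1) _ _ (loE _ p2) pc
      obtain ⟨-, t, h1, h2, h3, h4, h5⟩ := pc
      obtain ⟨-, t', h1', h2', h3', h4', h5'⟩ := qc
      rw [hseg _ _ (loE _ p1), hseg _ _ (loE _ p2)] at h5
      rw [hseg _ _ (loE _ q1), hseg _ _ (loE _ q2), ← hpq.1, ← hpq.2] at h5'
      have htt : t = t' := by
        by_contra hne
        exact hll (huniq _ _ t t' hne h5 h5')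
      subst htt
      exact Prod.ext (same _ _ (loE _ p1) _ (hpq.1 ▸ loE _ q1) t h1 h2 h1' h2')
        (same _ _ (loE _ p2) _ (hpq.2 ▸ loE _ q2) t h3 h4 h3' h4')
  calc L.card * (r - 1) * (k + 1) ^ 2 ≤ E.card * (k + 1) ^ 2 := by gcongr
    _ ≤ _ := amp.trans (by gcongr)

open Module

/-- points (relative to the centre `U`). -/
def IsPts {V : Type} [AddCommGroup V] [Module ℝ V] (U : Submodule ℝ V)
    (Q : Finset (Submodule ℝ V)) : Prop :=
  ∀ q ∈ Q, U ≤ q ∧ finrank ℝ q = finrank ℝ U + 1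

section
variable {V : Type} [AddCommGroup V] [Module ℝ V] [FiniteDimensional ℝ V]

lemma avoid {κ : Type} [Finite κ] (U : Submodule ℝ V) (z : κ → V) (hz : ∀ k, z k ∉ U) :
    ∃ φ : V →ₗ[ℝ] ℝ, U ≤ LinearMap.ker φ ∧ ∀ k, φ (z k) ≠ 0 := by
  obtain ⟨f, hf⟩ := Module.exists_dual_forall_apply_ne_zero (K := ℝ) (fun k => U.mkQ (z k)) (by
    intro k; simpa using hz k)
  refine ⟨f.comp U.mkQ, ?_, fun k => by simpa using hf k⟩
  intro u hu
  have : U.mkQ u = 0 := by simpa using hu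
  simp only [LinearMap.mem_ker, LinearMap.comp_apply, this, map_zero]

lemma pt_le {U q S : Submodule ℝ V} (hUq : U ≤ q) (hf : finrank ℝ q = finrank ℝ U + 1) {v : V}
    (hvq : v ∈ q) (hvU : v ∉ U) (hUS : U ≤ S) (hvS : v ∈ S) : q ≤ S := by
  have h1 : U < U ⊔ Submodule.span ℝ {v} := by
    refine lt_of_le_of_ne le_sup_left (fun h => hvU ?_)
    rw [h]; exact Submodule.mem_sup_right (Submodule.mem_span_singleton_self v)
  have h2 := Submodule.finrank_lt_finrank_of_lt h1
  have h3 : U ⊔ Submodule.span ℝ {v} ≤ q := sup_le hUq (by simpa using hvq)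
  have h4 := Submodule.eq_of_le_of_finrank_le h3 (by omega)
  rw [← h4]
  exact sup_le hUS (by simpa using hvS)

lemma pts_eq {U q q' : Submodule ℝ V} (hf : finrank ℝ q = finrank ℝ U + 1)
    (hf' : finrank ℝ q' = finrank ℝ U + 1) (h : q ≤ q') : q = q' :=
  Submodule.eq_of_le_of_finrank_le h (by omega)

lemma sup_rank {U q q' : Submodule ℝ V} (hU : U ≤ q) (hf : finrank ℝ q = finrank ℝ U + 1)
    (hU' : U ≤ q') (hf' : finrank ℝ q' = finrank ℝ U + 1) (hne : q ≠ q') :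
    finrank ℝ (q ⊔ q' : Submodule ℝ V) = finrank ℝ U + 2 := by
  have h1 := Submodule.finrank_sup_add_finrank_inf_eq q q'
  have h2 : finrank ℝ U ≤ finrank ℝ (q ⊓ q' : Submodule ℝ V) := Submodule.finrank_mono (le_inf hU hU')
  have h3 : q ⊓ q' < q := by
    refine lt_of_le_of_ne inf_le_left (fun h => hne ?_)
    exact pts_eq hf hf' (inf_eq_left.1 h)
  have h4 := Submodule.finrank_lt_finrank_of_lt h3
  omega

lemma sup_eq_line {U q q' W : Submodule ℝ V} (hU : U ≤ q) (hf : finrank ℝ q = finrank ℝ U + 1)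
    (hU' : U ≤ q') (hf' : finrank ℝ q' = finrank ℝ U + 1) (hne : q ≠ q')
    (hW : finrank ℝ W = finrank ℝ U + 2) (h : q ≤ W) (h' : q' ≤ W) : q ⊔ q' = W :=
  Submodule.eq_of_le_of_finrank_le (sup_le h h') (by rw [sup_rank hU hf hU' hf' hne, hW])

open Classical in
lemma st_rel (U : Submodule ℝ V) (Q : Finset (Submodule ℝ V)) (hQ : IsPts U Q)
    (Ws : Finset (Submodule ℝ V)) (hW : ∀ W ∈ Ws, finrank ℝ W = finrank ℝ U + 2)
    (r : ℕ) (hr : 2 ≤ r) (hWr : ∀ W ∈ Ws, r ≤ (Q.filter (fun q => q ≤ W)).card) :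
    (Ws.card : ℝ) * r ^ 3 ≤ 2304 * ((Q.card : ℝ) ^ 2 + Q.card * r ^ 2) := by
  have hex : ∀ i : Q, ∃ v : V, v ∈ i.1 ∧ v ∉ U := by
    intro i
    by_contra hcon
    push Not at hcon
    have h1 : i.1 ≤ U := hcon
    have h2 := Submodule.finrank_mono h1
    have := (hQ i.1 i.2).2
    omega
  choose v vi vU using hex
  have hU : ∀ i : Q, U ≤ i.1 := fun i => (hQ i.1 i.2).1
  have hF : ∀ i : Q, finrank ℝ i.1 = finrank ℝ U + 1 := fun i => (hQ i.1 i.2).2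
  have F0 : ∀ (i : Q) (S : Submodule ℝ V), U ≤ S → v i ∈ S → i.1 ≤ S := fun i S h1 h2 =>
    pt_le (hU i) (hF i) (vi i) (vU i) h1 h2
  obtain ⟨h, hhU, hh⟩ := avoid U v vU
  obtain ⟨f, hfU, hf⟩ := avoid (κ := {p : Q × Q // p.1 ≠ p.2}) U
    (fun p => h (v p.1.2) • v p.1.1 - h (v p.1.1) • v p.1.2) (by
      rintro ⟨⟨i, j⟩, hij⟩ hcon
      simp only at hij hcon
      have h1 : h (v j) • v i ∈ j.1 := by
        have := add_mem (hU j hcon) (Submodule.smul_mem j.1 (h (v i)) (vi j))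
        simpa using this
      have h2 : v i ∈ j.1 := (Submodule.smul_mem_iff _ (hh j)).1 h1
      exact hij (Subtype.ext (pts_eq (hF i) (hF j) (F0 i j.1 (hU j) h2))))
  have hf' : ∀ i j : Q, i ≠ j → f (v i) * h (v j) - f (v j) * h (v i) ≠ 0 := by
    intro i j hij
    have := hf ⟨(i, j), hij⟩
    simp only [map_sub, map_smul, smul_eq_mul] at this
    intro h0; apply this; linarith
  obtain ⟨g, hgU, hg⟩ := avoid (κ := {p : Q × Q × Q // p.1 ≠ p.2.1 ∧ v p.2.2 ∉ p.1.1 ⊔ p.2.1.1}) U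
    (fun p => (f (v p.1.2.1) * h (v p.1.2.2) - f (v p.1.2.2) * h (v p.1.2.1)) • v p.1.1 +
      (f (v p.1.2.2) * h (v p.1.1) - f (v p.1.1) * h (v p.1.2.2)) • v p.1.2.1 +
      (f (v p.1.1) * h (v p.1.2.1) - f (v p.1.2.1) * h (v p.1.1)) • v p.1.2.2) (by
      rintro ⟨⟨i, j, k⟩, hij, hk⟩ hcon
      simp only at hij hcon hk
      apply hk
      have h0 := hf' i j hij
      have h1 := Submodule.mem_sup_left (T := j.1) (hU i hcon)
      have h2 := Submodule.smul_mem (i.1 ⊔ j.1) (f (v j) * h (v k) - f (v k) * h (v j))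
        (Submodule.mem_sup_left (T := j.1) (vi i))
      have h3 := Submodule.smul_mem (i.1 ⊔ j.1) (f (v k) * h (v i) - f (v i) * h (v k))
        (Submodule.mem_sup_right (S := i.1) (vi j))
      rw [← Submodule.smul_mem_iff _ h0]
      exact ((Submodule.add_mem_iff_right _ (add_mem h2 h3)).1 h1))
  set x : Q → ℝ := fun i => f (v i) / h (v i) with hx
  set y : Q → ℝ := fun i => g (v i) / h (v i) with hy
  have xinj : Function.Injective x := by
    intro i j hij
    by_contra hne
    apply hf' i j hne
    simp only [hx] at hij
    rw [div_eq_div_iff (hh i) (hh j)] at hij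
    linarith
  have hlin : ∀ W ∈ Ws, ∃ l : ℝ × ℝ, ∃ i j : Q, i ≠ j ∧ i.1 ⊔ j.1 = W ∧
      W ≤ LinearMap.ker (g - l.1 • f - l.2 • h) := by
    intro W hWW
    have h2 : 1 < (Q.filter (fun q => q ≤ W)).card := lt_of_lt_of_le (by omega) (hWr W hWW)
    obtain ⟨i, hi, j, hj, hij⟩ := Finset.one_lt_card.1 h2
    rw [Finset.mem_filter] at hi hj
    set i' : Q := ⟨i, hi.1⟩
    set j' : Q := ⟨j, hj.1⟩
    have hij' : i' ≠ j' := fun h => hij (congrArg Subtype.val h)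
    have heq : i'.1 ⊔ j'.1 = W :=
      sup_eq_line (hU i') (hF i') (hU j') (hF j') hij (hW W hWW) hi.2 hj.2
    have hxne : x j' - x i' ≠ 0 := fun h => hij' (xinj (by linarith))
    set a := (y j' - y i') / (x j' - x i') with ha
    refine ⟨(a, y i' - a * x i'), i', j', hij', heq, ?_⟩
    rw [← heq]
    have hUk : U ≤ LinearMap.ker (g - a • f - (y i' - a * x i') • h) := by
      intro u hu
      have h1 : g u = 0 := hgU hu
      have h2 : f u = 0 := hfU hu
      have h3 : h u = 0 := hhU hu
      simp [h1, h2, h3]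
    have e1 : ∀ k : Q, g (v k) = y k * h (v k) := fun k => by
      simp only [hy]; rw [div_mul_cancel₀ _ (hh k)]
    have e2 : ∀ k : Q, f (v k) = x k * h (v k) := fun k => by
      simp only [hx]; rw [div_mul_cancel₀ _ (hh k)]
    refine sup_le (F0 _ _ hUk ?_) (F0 _ _ hUk ?_)
    · simp only [LinearMap.mem_ker, LinearMap.sub_apply, LinearMap.smul_apply, smul_eq_mul, e1, e2]
      ring
    · simp only [LinearMap.mem_ker, LinearMap.sub_apply, LinearMap.smul_apply, smul_eq_mul, e1, e2]
      have : a * (x j' - x i') = y j' - y i' := by rw [ha, div_mul_cancel₀ _ hxne]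
      linear_combination -h (v j') * this
  rcases isEmpty_or_nonempty Q with hemp | hemp
  · have : Ws = ∅ := by
      apply Finset.eq_empty_of_forall_notMem
      intro W hWW
      obtain ⟨-, i, -⟩ := hlin W hWW
      exact hemp.elim i
    rw [this]; simp; positivity
  choose! l i j hij hsup hker using hlin
  have hinj : Set.InjOn l Ws := by
    intro W hWW W' hWW' hll
    by_contra hne
    have hnle : ¬ W' ≤ W := fun hle => hne
      (Submodule.eq_of_le_of_finrank_le hle (by rw [hW W hWW, hW W' hWW'])).symm
    have hk : ∃ k : Q, v k ∉ W ∧ v k ∈ W' := by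
      by_contra hcon
      push Not at hcon
      have hUW : U ≤ W := by rw [← hsup W hWW]; exact le_sup_of_le_left (hU _)
      have m1 : v (i W') ∈ W' := (hsup W' hWW').le (Submodule.mem_sup_left (vi _))
      have m2 : v (j W') ∈ W' := (hsup W' hWW').le (Submodule.mem_sup_right (vi _))
      apply hnle
      rw [← hsup W' hWW']
      refine sup_le (F0 _ _ hUW ?_) (F0 _ _ hUW ?_)
      · by_contra hc; exact hcon _ hc m1
      · by_contra hc; exact hcon _ hc m2
    obtain ⟨k, hkW, hkW'⟩ := hk
    have := hg ⟨(i W, j W, k), hij W hWW, by rw [hsup W hWW]; exact hkW⟩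
    apply this
    have z1 := hker W hWW ((hsup W hWW).le (Submodule.mem_sup_left (vi (i W))))
    have z2 := hker W hWW ((hsup W hWW).le (Submodule.mem_sup_right (vi (j W))))
    have z3 := hker W' hWW' hkW'
    rw [← hll] at z3
    simp only [LinearMap.mem_ker, LinearMap.sub_apply, LinearMap.smul_apply, smul_eq_mul] at z1 z2 z3
    simp only [map_add, map_smul, smul_eq_mul]
    have z1' : g (v (i W)) = (l W).1 * f (v (i W)) + (l W).2 * h (v (i W)) := by linarith
    have z2' : g (v (j W)) = (l W).1 * f (v (j W)) + (l W).2 * h (v (j W)) := by linarith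
    have z3' : g (v k) = (l W).1 * f (v k) + (l W).2 * h (v k) := by linarith
    rw [z1', z2', z3']
    ring
  have := st_plane x y xinj (Ws.image l) r hr (by
    intro l' hl'
    obtain ⟨W, hWW, rfl⟩ := Finset.mem_image.1 hl'
    refine (hWr W hWW).trans ?_
    have : (Q.filter (fun q => q ≤ W)) ⊆
        (Finset.univ.filter (fun i : Q => y i = (l W).1 * x i + (l W).2)).image Subtype.val := by
      intro q hq
      rw [Finset.mem_filter] at hq
      refine Finset.mem_image.2 ⟨⟨q, hq.1⟩, ?_, rfl⟩
      have z := hker W hWW (hq.2 (vi ⟨q, hq.1⟩))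
      simp only [LinearMap.mem_ker, LinearMap.sub_apply, LinearMap.smul_apply, smul_eq_mul] at z
      simp only [Finset.mem_filter, Finset.mem_univ, true_and, hx, hy]
      have := hh ⟨q, hq.1⟩
      field_simp
      linarith
    refine (Finset.card_le_card this).trans (Finset.card_image_le.trans ?_)
    apply le_of_eq
    congr!)
  rw [Finset.card_image_of_injOn hinj] at this
  simpa using this
end

section
open Classical

/-- number of points on a line -/
noncomputable def lsz {α β : Type} (pts : Finset α) (inc : α → β → Prop) (l : β) : ℕ :=
  (pts.filter (fun a => inc a l)).card

noncomputable def lset {α β : Type} (pts : Finset α) (ln : α → α → β) : Finset β :=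
  pts.offDiag.image (fun p => ln p.1 p.2)

structure LinSys {α β : Type} (pts : Finset α) (ln : α → α → β) (inc : α → β → Prop) : Prop where
  inc_left : ∀ a ∈ pts, ∀ b ∈ pts, a ≠ b → inc a (ln a b)
  inc_right : ∀ a ∈ pts, ∀ b ∈ pts, a ≠ b → inc b (ln a b)
  uniq : ∀ a ∈ pts, ∀ b ∈ pts, a ≠ b → ∀ l ∈ lset pts ln, inc a l → inc b l → ln a b = l
  st : ∀ r : ℕ, 2 ≤ r → ∀ S : Finset β, S ⊆ lset pts ln → (∀ l ∈ S, r ≤ lsz pts inc l) →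
    (S.card : ℝ) * r ^ 3 ≤ 2304 * ((pts.card : ℝ) ^ 2 + pts.card * r ^ 2)

lemma ln_mem {α β : Type} {pts : Finset α} {ln : α → α → β} {a b : α} (ha : a ∈ pts) (hb : b ∈ pts)
    (h : a ≠ b) : ln a b ∈ lset pts ln :=
  Finset.mem_image.2 ⟨(a, b), Finset.mem_offDiag.2 ⟨ha, hb, h⟩, rfl⟩

lemma offDiag_sum {α : Type} (pts : Finset α) (R : α → α → Prop) :
    (pts.offDiag.filter (fun p => R p.1 p.2)).card =
      ∑ a ∈ pts, ((pts.erase a).filter (fun b => R a b)).card := by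
  have h : pts.offDiag.filter (fun p => R p.1 p.2) =
      (pts ×ˢ pts).filter (fun p => p.2 ≠ p.1 ∧ R p.1 p.2) := by
    ext ⟨a, b⟩
    simp only [Finset.mem_filter, Finset.mem_offDiag, Finset.mem_product]
    constructor
    · rintro ⟨⟨h1, h2, h3⟩, h4⟩; exact ⟨⟨h1, h2⟩, h3.symm, h4⟩
    · rintro ⟨⟨h1, h2⟩, h3, h4⟩; exact ⟨⟨h1, h2, h3.symm⟩, h4⟩
  rw [h, Finset.card_filter, Finset.sum_product]
  refine Finset.sum_congr rfl fun a _ => ?_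
  rw [← Finset.card_filter]
  congr 1
  ext b
  simp only [Finset.mem_filter, Finset.mem_erase]
  tauto

lemma sq_le_sum (K s : ℕ) (h : K ≤ s) :
    ((s : ℝ)) ^ 2 ≤ (K : ℝ) ^ 2 + ∑ j ∈ Finset.Ioc K s, 2 * (j : ℝ) := by
  induction s, h using Nat.le_induction with
  | base => simp
  | succ s hs ih =>
    rw [← Finset.insert_Ioc_right_eq_Ioc_add_one hs, Finset.sum_insert (by simp)]
    push_cast
    nlinarith

variable {α β : Type} {pts : Finset α} {ln : α → α → β} {inc : α → β → Prop}

lemma medium_pairs (hs : LinSys pts ln inc) (K : ℕ) (hK : 2 ≤ K) :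
    ((pts.offDiag.filter (fun p => K ≤ lsz pts inc (ln p.1 p.2) ∧
      lsz pts inc (ln p.1 p.2) * K ≤ pts.card)).card : ℝ) ≤ 13824 * (pts.card : ℝ) ^ 2 / K := by
  set n := pts.card with hn
  set D := pts.offDiag.filter (fun p => K ≤ lsz pts inc (ln p.1 p.2) ∧
      lsz pts inc (ln p.1 p.2) * K ≤ n) with hD
  set M := (lset pts ln).filter (fun l => K ≤ lsz pts inc l ∧ lsz pts inc l * K ≤ n) with hM
  have hK0 : (0 : ℝ) < K := by positivity
  by_cases hKn : K * K ≤ n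
  swap
  · have : D = ∅ := by
      apply Finset.eq_empty_of_forall_notMem
      intro p hp
      rw [hD, Finset.mem_filter] at hp
      have := Nat.mul_le_mul_right K hp.2.1
      omega
    rw [this]; simp; positivity
  have hmap : ∀ p ∈ D, ln p.1 p.2 ∈ M := by
    intro p hp
    rw [hD, Finset.mem_filter] at hp
    exact Finset.mem_filter.2 ⟨Finset.mem_image.2 ⟨p, hp.1, rfl⟩, hp.2⟩
  have h1 : D.card = ∑ l ∈ M, (D.filter (fun p => ln p.1 p.2 = l)).card :=
    Finset.card_eq_sum_card_fiberwise hmap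
  have h2 : ∀ l ∈ M, (D.filter (fun p => ln p.1 p.2 = l)).card ≤ (lsz pts inc l) ^ 2 := by
    intro l hl
    rw [sq, lsz, ← Finset.card_product]
    apply Finset.card_le_card
    intro p hp
    simp only [hD, Finset.mem_filter, Finset.mem_offDiag, Finset.mem_product] at hp ⊢
    obtain ⟨⟨⟨a1, a2, a3⟩, -⟩, a4⟩ := hp
    rw [← a4]
    exact ⟨⟨a1, hs.inc_left _ a1 _ a2 a3⟩, ⟨a2, hs.inc_right _ a1 _ a2 a3⟩⟩
  set n' := n / K with hn'
  have hKn' : K ≤ n' := (Nat.le_div_iff_mul_le (by omega)).2 hKn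
  have h3 : ∀ l ∈ M, ((D.filter (fun p => ln p.1 p.2 = l)).card : ℝ) ≤
      (K : ℝ) ^ 2 + ∑ j ∈ Finset.Ioc K n', if j ≤ lsz pts inc l then 2 * (j : ℝ) else 0 := by
    intro l hl
    have a1 : ((D.filter (fun p => ln p.1 p.2 = l)).card : ℝ) ≤ (lsz pts inc l : ℝ) ^ 2 := by
      exact_mod_cast h2 l hl
    obtain ⟨-, b1, b2⟩ := Finset.mem_filter.1 hl
    refine a1.trans ((sq_le_sum K _ b1).trans ?_)
    gcongr
    rw [← Finset.sum_filter]
    apply Finset.sum_le_sum_of_subset_of_nonneg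
    · intro j hj
      rw [Finset.mem_Ioc] at hj
      have : lsz pts inc l ≤ n' := (Nat.le_div_iff_mul_le (by omega)).2 b2
      simp only [Finset.mem_filter, Finset.mem_Ioc]
      omega
    · intros; positivity
  have h4 : (D.card : ℝ) ≤ ∑ l ∈ M, ((K : ℝ) ^ 2 +
      ∑ j ∈ Finset.Ioc K n', if j ≤ lsz pts inc l then 2 * (j : ℝ) else 0) := by
    rw [h1]; push_cast; exact Finset.sum_le_sum h3
  rw [Finset.sum_add_distrib, Finset.sum_comm] at h4
  have h5 : ∀ j ∈ Finset.Ioc K n', (∑ l ∈ M, if j ≤ lsz pts inc l then 2 * (j : ℝ) else 0) ≤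
      4608 * (n : ℝ) ^ 2 * ((j : ℝ) ^ 2)⁻¹ + 4608 * n := by
    intro j hj
    rw [Finset.mem_Ioc] at hj
    have hj0 : (0 : ℝ) < j := by exact_mod_cast (by omega : 0 < j)
    rw [← Finset.sum_filter]
    simp only [Finset.sum_const, nsmul_eq_mul]
    have := hs.st j (by omega) (M.filter (fun l => j ≤ lsz pts inc l))
      ((Finset.filter_subset _ _).trans (Finset.filter_subset _ _))
      (fun l hl => (Finset.mem_filter.1 hl).2)
    rw [← hn] at this
    set q : ℝ := ((M.filter (fun l => j ≤ lsz pts inc l)).card : ℝ)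
    have e : 4608 * (n : ℝ) ^ 2 * ((j : ℝ) ^ 2)⁻¹ + 4608 * n =
      2 * (2304 * ((n : ℝ) ^ 2 + n * j ^ 2)) / j ^ 2 := by field_simp; ring
    rw [e, le_div_iff₀ (by positivity)]
    linarith
  have h6 : (M.card : ℝ) * K ^ 2 ≤ 4608 * n ^ 2 / K := by
    have := hs.st K hK M (Finset.filter_subset _ _) (fun l hl => (Finset.mem_filter.1 hl).2.1)
    rw [← hn] at this
    rw [le_div_iff₀ hK0]
    have h7 : (n : ℝ) * (K ^ 2) ≤ n * n := by
      gcongr; rw [sq]; exact_mod_cast hKn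
    nlinarith
  have h8 := Finset.sum_le_sum h5
  rw [Finset.sum_add_distrib, ← Finset.mul_sum] at h8
  have h9 := sum_Ioc_inv_sq_le_sub (α := ℝ) (by omega : K ≠ 0) hKn'
  have h10 : (∑ j ∈ Finset.Ioc K n', ((j : ℝ) ^ 2)⁻¹) ≤ 1 / K := by
    refine h9.trans ?_
    rw [one_div]
    have : (0 : ℝ) ≤ ((n' : ℝ))⁻¹ := by positivity
    linarith
  have h11 : 4608 * (n : ℝ) ^ 2 * (∑ j ∈ Finset.Ioc K n', ((j : ℝ) ^ 2)⁻¹) ≤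
      4608 * (n : ℝ) ^ 2 * (1 / K) := by gcongr
  have h12 : (∑ j ∈ Finset.Ioc K n', 4608 * (n : ℝ)) ≤ 4608 * (n : ℝ) ^ 2 / K := by
    simp only [Finset.sum_const, nsmul_eq_mul, Nat.card_Ioc]
    have : ((n' - K : ℕ) : ℝ) ≤ n / K := by
      refine le_trans ?_ (Nat.cast_div_le (α := ℝ))
      exact_mod_cast Nat.sub_le _ _
    calc ((n' - K : ℕ) : ℝ) * (4608 * n) ≤ (n / K) * (4608 * n) := by gcongr
      _ = _ := by ring
  simp only [Finset.sum_const, nsmul_eq_mul] at h4 h12 h8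
  have e2 : 13824 * (n : ℝ) ^ 2 / K = 4608 * n ^ 2 / K + 4608 * (n : ℝ) ^ 2 * (1 / K) +
    4608 * (n : ℝ) ^ 2 / K := by ring
  rw [e2]
  linarith

noncomputable def richL (pts : Finset α) (ln : α → α → β) (inc : α → β → Prop) (K : ℕ) : Finset β :=
  (lset pts ln).filter (fun l => pts.card < lsz pts inc l * K)

lemma rich_lines (hs : LinSys pts ln inc) (K : ℕ) (hK : 2 ≤ K) (hn : K ≤ pts.card) :
    ((richL pts ln inc K).card : ℝ) ≤ 4608 * (K : ℝ) ^ 3 := by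
  set r := pts.card / K + 1 with hr
  have h1 : 1 ≤ pts.card / K := (Nat.le_div_iff_mul_le (by omega)).2 (by omega)
  have hst := hs.st r (by omega) (richL pts ln inc K) (Finset.filter_subset _ _) (by
    intro l hl
    have := (Finset.mem_filter.1 hl).2
    rw [hr]
    exact (Nat.div_lt_iff_lt_mul (by omega)).2 this)
  have h2 : (pts.card : ℝ) ≤ r * K := by
    have : pts.card < K * r := by rw [hr]; exact Nat.lt_mul_div_succ _ (by omega)
    have h3 : (pts.card : ℝ) < K * r := by exact_mod_cast this
    linarith
  have hr1 : (1 : ℝ) ≤ r := by rw [hr]; push_cast; linarith [(Nat.cast_nonneg (pts.card / K) : (0 : ℝ) ≤ _)]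
  have hK1 : (1 : ℝ) ≤ K := by exact_mod_cast (by omega : 1 ≤ K)
  have hr3 : (0 : ℝ) < (r : ℝ) ^ 3 := by positivity
  refine le_of_mul_le_mul_right (hst.trans ?_) hr3
  have h4 : (pts.card : ℝ) ^ 2 ≤ (K : ℝ) ^ 3 * (r : ℝ) ^ 3 := by
    have h6 : (1 : ℝ) ≤ (r : ℝ) * (K : ℝ) := by nlinarith
    calc (pts.card : ℝ) ^ 2 ≤ ((r : ℝ) * (K : ℝ)) ^ 2 := by gcongr
      _ = ((r : ℝ) * (K : ℝ)) ^ 2 * 1 := by ring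
      _ ≤ ((r : ℝ) * (K : ℝ)) ^ 2 * ((r : ℝ) * (K : ℝ)) := by
        gcongr
      _ = _ := by ring
  have h5 : (pts.card : ℝ) * (r : ℝ) ^ 2 ≤ (K : ℝ) ^ 3 * (r : ℝ) ^ 3 := by
    calc (pts.card : ℝ) * (r : ℝ) ^ 2 ≤ ((r : ℝ) * (K : ℝ)) * (r : ℝ) ^ 2 := by gcongr
      _ = (K : ℝ) ^ 1 * (r : ℝ) ^ 3 := by ring
      _ ≤ (K : ℝ) ^ 3 * (r : ℝ) ^ 3 := by
        gcongr
        norm_num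
  nlinarith

lemma poor_le (hs : LinSys pts ln inc) (K : ℕ) (a : α) (ha : a ∈ pts) (S : Finset α)
    (hS : S ⊆ pts.erase a) (hSK : ∀ b ∈ S, lsz pts inc (ln a b) < K) :
    S.card ≤ K * (S.image (ln a)).card := by
  apply Finset.card_le_mul_card_image
  intro l hl
  obtain ⟨b, hb, rfl⟩ := Finset.mem_image.1 hl
  refine le_trans ?_ (hSK b hb).le
  apply Finset.card_le_card
  intro c hc
  rw [Finset.mem_filter] at hc ⊢
  have hc' := Finset.mem_erase.1 (hS hc.1)
  refine ⟨hc'.2, ?_⟩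
  rw [← hc.2]
  exact hs.inc_right a ha c hc'.2 hc'.1.symm

lemma multi_rich (hs : LinSys pts ln inc) (R : Finset β) (hR : R ⊆ lset pts ln) :
    (pts.filter (fun a => ∃ l ∈ R, ∃ l' ∈ R, l ≠ l' ∧ inc a l ∧ inc a l')).card ≤
      R.card * R.card := by
  rw [← Finset.card_product]
  have : ∀ a ∈ pts.filter (fun a => ∃ l ∈ R, ∃ l' ∈ R, l ≠ l' ∧ inc a l ∧ inc a l'),
      ∃ q : β × β, q ∈ R ×ˢ R ∧ q.1 ≠ q.2 ∧ inc a q.1 ∧ inc a q.2 := by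
    intro a ha
    obtain ⟨l, hl, l', hl', h⟩ := (Finset.mem_filter.1 ha).2
    exact ⟨(l, l'), Finset.mem_product.2 ⟨hl, hl'⟩, h⟩
  rcases isEmpty_or_nonempty (β × β) with he | he
  · have h0 : (pts.filter (fun a => ∃ l ∈ R, ∃ l' ∈ R, l ≠ l' ∧ inc a l ∧ inc a l')) = ∅ := by
      apply Finset.eq_empty_of_forall_notMem
      intro a ha
      obtain ⟨q, -⟩ := this a ha
      exact he.elim q
    rw [h0]; simp
  choose! q q1 q2 q3 q4 using this
  apply Finset.card_le_card_of_injOn q q1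
  intro a ha b hb hab
  by_contra hne
  have ha' := (Finset.mem_filter.1 ha).1
  have hb' := (Finset.mem_filter.1 hb).1
  have m := Finset.mem_product.1 (q1 a ha)
  have e1 := hs.uniq a ha' b hb' hne _ (hR m.1) (q3 a ha) (hab ▸ q3 b hb)
  have e2 := hs.uniq a ha' b hb' hne _ (hR m.2) (q4 a ha) (hab ▸ q4 b hb)
  exact q2 a ha (e1.symm.trans e2)

/-- Beck-type dichotomy. -/
lemma beck (ε : ℝ) (hε : 0 < ε) (hε1 : ε < 1) : ∃ c : ℝ, 0 < c ∧ c ≤ 1 ∧ ∃ M0 : ℕ,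
    ∀ {α β : Type} {pts : Finset α} {ln : α → α → β} {inc : α → β → Prop},
      LinSys pts ln inc → M0 ≤ pts.card →
      (∃ l ∈ lset pts ln, (1 - ε) * pts.card < lsz pts inc l) ∨
      c * pts.card ≤ ((pts.filter (fun a => c * pts.card ≤
        (((pts.erase a).image (ln a)).card : ℝ))).card : ℝ) := by
  set K : ℕ := ⌈4 * 13824 / ε⌉₊ + 2 with hKdef
  have hK2 : 2 ≤ K := by omega
  have hKε : 13824 / (K : ℝ) ≤ ε / 4 := by
    have : 4 * 13824 / ε ≤ (K : ℝ) := by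
      rw [hKdef]; push_cast; linarith [Nat.le_ceil (4 * 13824 / ε)]
    rw [div_le_iff₀ hε] at this
    rw [div_le_iff₀ (by positivity)]
    linarith
  set R0 : ℝ := 4608 * (K : ℝ) ^ 3 with hR0
  set c : ℝ := ε / (4 * (1 + K)) with hc
  have hK0 : (0 : ℝ) < K := by positivity
  have hc0 : 0 < c := by positivity
  have hcK : c * (1 + K) = ε / 4 := by rw [hc]; field_simp
  refine ⟨c, hc0, by nlinarith, K + ⌈2 * (R0 ^ 2 + 1) / ε⌉₊ + 1, ?_⟩
  intro α β pts ln inc hs hn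
  by_contra hcon
  push Not at hcon
  obtain ⟨hno, hfew⟩ := hcon
  set n := pts.card with hndef
  have hnK : K ≤ n := by omega
  have hnbig : 2 * (R0 ^ 2 + 1) / ε < n := by
    have h1 := Nat.le_ceil (2 * (R0 ^ 2 + 1) / ε)
    have h2 : ((⌈2 * (R0 ^ 2 + 1) / ε⌉₊ : ℕ) : ℝ) < n := by exact_mod_cast (by omega)
    linarith
  have hn0 : (0 : ℝ) < n := by exact_mod_cast (by omega : 0 < n)
  set R := richL pts ln inc K with hRdef
  have hRc : (R.card : ℝ) ≤ R0 := rich_lines hs K hK2 hnK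
  have hRsub : R ⊆ lset pts ln := Finset.filter_subset _ _
  set poor := pts.offDiag.filter (fun p => lsz pts inc (ln p.1 p.2) < K) with hpoor
  set med := pts.offDiag.filter (fun p => K ≤ lsz pts inc (ln p.1 p.2) ∧
      lsz pts inc (ln p.1 p.2) * K ≤ n) with hmed
  set rich := pts.offDiag.filter (fun p => ln p.1 p.2 ∈ R) with hrich
  have hcover : pts.offDiag ⊆ poor ∪ (med ∪ rich) := by
    intro p hp
    simp only [hpoor, hmed, hrich, Finset.mem_union, Finset.mem_filter, hp, true_and]
    have hp' := Finset.mem_offDiag.1 hp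
    by_cases h1 : lsz pts inc (ln p.1 p.2) < K
    · left; exact h1
    · by_cases h2 : lsz pts inc (ln p.1 p.2) * K ≤ n
      · right; left; exact ⟨by omega, h2⟩
      · right; right
        exact Finset.mem_filter.2 ⟨ln_mem hp'.1 hp'.2.1 hp'.2.2, by omega⟩
  have hsum : (n : ℝ) ^ 2 - n ≤ poor.card + med.card + rich.card := by
    have h1 := (Finset.card_le_card hcover).trans ((Finset.card_union_le _ _).trans
      (Nat.add_le_add_left (Finset.card_union_le _ _) _))
    rw [Finset.offDiag_card, ← hndef] at h1
    have h2 : ((n * n - n : ℕ) : ℝ) ≤ ((poor.card + (med.card + rich.card) : ℕ) : ℝ) := by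
      exact_mod_cast h1
    rw [Nat.cast_sub (Nat.le_mul_self n)] at h2
    push_cast at h2
    linarith
  have hmedle : (med.card : ℝ) ≤ ε / 4 * n ^ 2 := by
    refine (medium_pairs hs K hK2).trans ?_
    rw [← hndef]
    calc 13824 * (n : ℝ) ^ 2 / K = (13824 / K) * n ^ 2 := by ring
      _ ≤ _ := by gcongr
  have hpoorle : (poor.card : ℝ) ≤ ε / 4 * n ^ 2 := by
    have e0 : poor.card = ∑ a ∈ pts, ((pts.erase a).filter (fun b => lsz pts inc (ln a b) < K)).card := by
      rw [hpoor]
      convert offDiag_sum pts (fun a b => lsz pts inc (ln a b) < K)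
    rw [e0]
    push_cast
    set G := pts.filter (fun a => c * n ≤ (((pts.erase a).image (ln a)).card : ℝ)) with hG
    have h1 : ∀ a ∈ pts, (((pts.erase a).filter (fun b => lsz pts inc (ln a b) < K)).card : ℝ) ≤
        (if a ∈ G then (n : ℝ) else 0) + K * (c * n) := by
      intro a ha
      split_ifs with haG
      · have : ((pts.erase a).filter (fun b => lsz pts inc (ln a b) < K)).card ≤ n :=
          Finset.card_le_card ((Finset.filter_subset _ _).trans (Finset.erase_subset _ _))
        have h2 : (((pts.erase a).filter (fun b => lsz pts inc (ln a b) < K)).card : ℝ) ≤ n := by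
          exact_mod_cast this
        have : 0 ≤ K * (c * n) := by positivity
        linarith
      · have h2 := poor_le hs K a ha ((pts.erase a).filter (fun b => lsz pts inc (ln a b) < K))
          (Finset.filter_subset _ _) (fun b hb => (Finset.mem_filter.1 hb).2)
        have h3 : (((pts.erase a).filter (fun b => lsz pts inc (ln a b) < K)).image (ln a)).card ≤
            ((pts.erase a).image (ln a)).card :=
          Finset.card_le_card (Finset.image_subset_image (Finset.filter_subset _ _))
        have h4 : (((pts.erase a).image (ln a)).card : ℝ) < c * n := by
          by_contra hge
          exact haG (Finset.mem_filter.2 ⟨ha, not_lt.1 hge⟩)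
        have h5 : (((pts.erase a).filter (fun b => lsz pts inc (ln a b) < K)).card : ℝ) ≤
            K * (((pts.erase a).image (ln a)).card : ℝ) := by
          exact_mod_cast h2.trans (Nat.mul_le_mul_left K h3)
        nlinarith
    refine (Finset.sum_le_sum h1).trans ?_
    rw [Finset.sum_add_distrib, ← Finset.sum_filter]
    simp only [Finset.sum_const, nsmul_eq_mul, ← hndef]
    have h6 : ((pts.filter (fun a => a ∈ G)).card : ℝ) ≤ c * n := by
      refine le_trans ?_ hfew.le
      have : pts.filter (fun a => a ∈ G) ⊆ G := fun a ha => (Finset.mem_filter.1 ha).2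
      exact_mod_cast Finset.card_le_card this
    have h7 : ε / 4 * (n : ℝ) ^ 2 = (c * n) * n + n * (K * (c * n)) := by rw [← hcK]; ring
    rw [h7]
    gcongr
  have hrichle : (rich.card : ℝ) ≤ R0 ^ 2 * n + (1 - ε) * n ^ 2 := by
    have e0 : rich.card = ∑ a ∈ pts, ((pts.erase a).filter (fun b => ln a b ∈ R)).card := by
      rw [hrich]
      convert offDiag_sum pts (fun a b => ln a b ∈ R)
    rw [e0]
    push_cast
    set B := pts.filter (fun a => ∃ l ∈ R, ∃ l' ∈ R, l ≠ l' ∧ inc a l ∧ inc a l') with hB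
    have hBc : (B.card : ℝ) ≤ R0 ^ 2 := by
      have : (B.card : ℝ) ≤ R.card * R.card := by exact_mod_cast multi_rich hs R hRsub
      nlinarith [(Nat.cast_nonneg R.card : (0 : ℝ) ≤ _)]
    have h0 : 0 ≤ (1 - ε) * n := mul_nonneg (by linarith) hn0.le
    have h1 : ∀ a ∈ pts, (((pts.erase a).filter (fun b => ln a b ∈ R)).card : ℝ) ≤
        (if a ∈ B then (n : ℝ) else 0) + (1 - ε) * n := by
      intro a ha
      split_ifs with haB
      · have : ((pts.erase a).filter (fun b => ln a b ∈ R)).card ≤ n :=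
          Finset.card_le_card ((Finset.filter_subset _ _).trans (Finset.erase_subset _ _))
        have h2 : (((pts.erase a).filter (fun b => ln a b ∈ R)).card : ℝ) ≤ n := by
          exact_mod_cast this
        linarith
      · rcases ((pts.erase a).filter (fun b => ln a b ∈ R)).eq_empty_or_nonempty with he | ⟨b, hb⟩
        · rw [he]; simpa using h0
        · obtain ⟨hb1, hb2⟩ := Finset.mem_filter.1 hb
          obtain ⟨hb3, hb4⟩ := Finset.mem_erase.1 hb1
          have hsub : ((pts.erase a).filter (fun b => ln a b ∈ R)) ⊆
              pts.filter (fun d => inc d (ln a b)) := by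
            intro d hd
            obtain ⟨hd1, hd2⟩ := Finset.mem_filter.1 hd
            obtain ⟨hd3, hd4⟩ := Finset.mem_erase.1 hd1
            refine Finset.mem_filter.2 ⟨hd4, ?_⟩
            have : ln a d = ln a b := by
              by_contra hne
              exact haB (Finset.mem_filter.2 ⟨ha, _, hd2, _, hb2, hne,
                hs.inc_left _ ha _ hd4 hd3.symm, hs.inc_left _ ha _ hb4 hb3.symm⟩)
            rw [← this]
            exact hs.inc_right _ ha _ hd4 hd3.symm
          have h3 := hno _ (hRsub hb2)
          have h4 : (((pts.erase a).filter (fun b => ln a b ∈ R)).card : ℝ) ≤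
            lsz pts inc (ln a b) := by exact_mod_cast Finset.card_le_card hsub
          linarith
    refine (Finset.sum_le_sum h1).trans ?_
    rw [Finset.sum_add_distrib, ← Finset.sum_filter]
    simp only [Finset.sum_const, nsmul_eq_mul, ← hndef]
    have h6 : ((pts.filter (fun a => a ∈ B)).card : ℝ) ≤ R0 ^ 2 := by
      refine le_trans ?_ hBc
      have : pts.filter (fun a => a ∈ B) ⊆ B := fun a ha => (Finset.mem_filter.1 ha).2
      exact_mod_cast Finset.card_le_card this
    have h7 : (1 - ε) * (n : ℝ) ^ 2 = n * ((1 - ε) * n) := by ring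
    rw [h7]
    gcongr
  rw [div_lt_iff₀ hε] at hnbig
  have : ε / 2 * (n : ℝ) * n ≤ (R0 ^ 2 + 1) * n := by nlinarith
  have := le_of_mul_le_mul_right this hn0
  linarith
end

section
open Classical
set_option linter.unusedSectionVars false
variable {V : Type} [AddCommGroup V] [Module ℝ V] [FiniteDimensional ℝ V]

abbrev sln (a b : Submodule ℝ V) : Submodule ℝ V := a ⊔ b
abbrev sinc (a l : Submodule ℝ V) : Prop := a ≤ l

lemma lset_rank {U : Submodule ℝ V} {Q : Finset (Submodule ℝ V)} (hQ : IsPts U Q)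
    {l : Submodule ℝ V} (hl : l ∈ lset Q sln) : finrank ℝ l = finrank ℝ U + 2 ∧
      ∃ q ∈ Q, q ≤ l := by
  obtain ⟨⟨a, b⟩, hab, rfl⟩ := Finset.mem_image.1 hl
  obtain ⟨ha, hb, hne⟩ := Finset.mem_offDiag.1 hab
  exact ⟨sup_rank (hQ a ha).1 (hQ a ha).2 (hQ b hb).1 (hQ b hb).2 hne, a, ha, le_sup_left⟩

lemma sub_linsys {U : Submodule ℝ V} {Q : Finset (Submodule ℝ V)} (hQ : IsPts U Q) :
    LinSys Q sln sinc where
  inc_left a _ b _ _ := le_sup_left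
  inc_right a _ b _ _ := le_sup_right
  uniq a ha b hb hne l hl h1 h2 :=
    sup_eq_line (hQ a ha).1 (hQ a ha).2 (hQ b hb).1 (hQ b hb).2 hne (lset_rank hQ hl).1 h1 h2
  st r hr S hS h := by
    refine st_rel U Q hQ S (fun W hW => (lset_rank hQ (hS hW)).1) r hr ?_
    intro W hW
    have := h W hW
    unfold lsz at this
    convert this

noncomputable def planesL (X : Finset (Submodule ℝ V)) (L : Submodule ℝ V) :
    Finset (Submodule ℝ V) :=
  (X.filter (fun s => ¬ s ≤ L)).image (fun s => L ⊔ s)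

lemma planesL_mem {X : Finset (Submodule ℝ V)} {L T : Submodule ℝ V} :
    T ∈ planesL X L ↔ ∃ s ∈ X, ¬ s ≤ L ∧ L ⊔ s = T := by
  simp only [planesL, Finset.mem_image, Finset.mem_filter, and_assoc]

lemma pt_rank {X : Finset (Submodule ℝ V)} (hX : IsPts ⊥ X) {s : Submodule ℝ V} (hs : s ∈ X) :
    finrank ℝ s = 1 := by
  have := (hX s hs).2
  rwa [finrank_bot, zero_add] at this

lemma planesL_pts {X : Finset (Submodule ℝ V)} (hX : IsPts ⊥ X) (L : Submodule ℝ V) :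
    IsPts L (planesL X L) := by
  intro T hT
  obtain ⟨s, hs, hsL, rfl⟩ := planesL_mem.1 hT
  refine ⟨le_sup_left, ?_⟩
  have h1 := Submodule.finrank_sup_add_finrank_inf_eq L s
  have h2 := pt_rank hX hs
  have h3 : finrank ℝ (L ⊓ s : Submodule ℝ V) < finrank ℝ s :=
    Submodule.finrank_lt_finrank_of_lt (lt_of_le_of_ne inf_le_right (fun h => hsL (inf_eq_right.1 h)))
  omega

lemma planesL_card_le (X : Finset (Submodule ℝ V)) (L : Submodule ℝ V) :
    (planesL X L).card ≤ X.card :=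
  Finset.card_image_le.trans (Finset.card_le_card (Finset.filter_subset _ _))

lemma not_le_of_mem {X : Finset (Submodule ℝ V)} (hX : IsPts ⊥ X) {p q : Submodule ℝ V}
    (hp : p ∈ X) (hq : q ∈ X) (h : q ≠ p) : ¬ q ≤ p := fun hle =>
  h (pts_eq (hX q hq).2 (hX p hp).2 hle)

lemma image_sub_planes {X : Finset (Submodule ℝ V)} (hX : IsPts ⊥ X) {p : Submodule ℝ V}
    (hp : p ∈ X) : (X.erase p).image (sln p) ⊆ planesL X p := by
  intro T hT
  obtain ⟨q, hq, rfl⟩ := Finset.mem_image.1 hT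
  obtain ⟨hne, hq⟩ := Finset.mem_erase.1 hq
  exact planesL_mem.2 ⟨q, hq, not_le_of_mem hX hp hq hne, rfl⟩

lemma chain_planes {X : Finset (Submodule ℝ V)} (hX : IsPts ⊥ X) {p Q : Submodule ℝ V}
    (hQ : Q ∈ planesL X p) : ((planesL X p).erase Q).image (sln Q) ⊆ planesL X Q := by
  intro T hT
  obtain ⟨Q', hQ', rfl⟩ := Finset.mem_image.1 hT
  obtain ⟨hne, hQ'⟩ := Finset.mem_erase.1 hQ'
  obtain ⟨s, hs, hsp, rfl⟩ := planesL_mem.1 hQ'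
  have hpQ := (planesL_pts hX p Q hQ)
  refine planesL_mem.2 ⟨s, hs, fun h => hne ?_, ?_⟩
  · exact pts_eq (planesL_pts hX p _ hQ').2 hpQ.2 (sup_le hpQ.1 h)
  · rw [sln, ← sup_assoc, sup_eq_left.2 hpQ.1]

/-- projecting a pencil in a plane through a transversal line -/
lemma transversal {X : Finset (Submodule ℝ V)} (hX : IsPts ⊥ X) {p l Y : Submodule ℝ V}
    (hpl : p ≤ l) (hl : finrank ℝ l = finrank ℝ p + 1) (hlY : ¬ l ≤ Y) :
    ((planesL X p).filter (fun Q => Q ≤ Y)).card ≤ (planesL X l).card := by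
  have hpts := planesL_pts hX p
  have key : ∀ Q ∈ (planesL X p).filter (fun Q => Q ≤ Y), Q ⊔ l ∈ planesL X l := by
    intro Q hQ
    obtain ⟨hQ, hQY⟩ := Finset.mem_filter.1 hQ
    have hr := hpts Q hQ
    obtain ⟨s, hs, hsp, rfl⟩ := planesL_mem.1 hQ
    refine planesL_mem.2 ⟨s, hs, fun h => hlY ?_, ?_⟩
    · have : p ⊔ s = l := pts_eq hr.2 hl (sup_le hpl h)
      rw [← this]; exact hQY
    · rw [sup_comm p s, sup_assoc, sup_eq_right.2 hpl, sup_comm]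
  refine Finset.card_le_card_of_injOn (fun Q => Q ⊔ l) key ?_
  intro Q hQ Q' hQ' h
  by_contra hne
  obtain ⟨hQ1, hQY⟩ := Finset.mem_filter.1 (Finset.mem_coe.1 hQ)
  obtain ⟨hQ1', hQY'⟩ := Finset.mem_filter.1 (Finset.mem_coe.1 hQ')
  have h1 := hpts Q hQ1
  have h2 := hpts Q' hQ1'
  have h3 := (planesL_pts hX l _ (key Q hQ)).2
  simp only at h
  have h4 : Q ⊔ Q' = Q ⊔ l := sup_eq_line h1.1 h1.2 h2.1 h2.2 hne (by rw [h3, hl]) le_sup_left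
    (by rw [h]; exact le_sup_left)
  exact hlY (le_trans (by rw [h4]; exact le_sup_right) (sup_le hQY hQY'))

end

section
open Classical
set_option linter.unusedSectionVars false
variable {V : Type} [AddCommGroup V] [Module ℝ V] [FiniteDimensional ℝ V]

/-- if the pencil at `p` is good, many `q` are good for `p`. -/
lemma good_point {X : Finset (Submodule ℝ V)} (hX : IsPts ⊥ X) {p : Submodule ℝ V}
    (t : ℝ) :
    ((planesL X p).filter (fun a => t ≤
        ((((planesL X p).erase a).image (sln a)).card : ℝ))).card ≤
      ((X.erase p).filter (fun q => t ≤ ((planesL X (p ⊔ q)).card : ℝ))).card := by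
  refine le_trans (Finset.card_le_card ?_)
    (Finset.card_image_le (s := ((X.erase p).filter (fun q => t ≤ ((planesL X (p ⊔ q)).card : ℝ))))
      (f := fun q => p ⊔ q))
  intro Q hQ
  obtain ⟨hQ, ht⟩ := Finset.mem_filter.1 hQ
  have hsub := Finset.card_le_card (chain_planes hX hQ)
  obtain ⟨s, hs, hsp, rfl⟩ := planesL_mem.1 hQ
  refine Finset.mem_image.2 ⟨s, Finset.mem_filter.2 ⟨Finset.mem_erase.2 ⟨?_, hs⟩, ?_⟩, rfl⟩
  · rintro rfl; exact hsp le_rfl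
  · exact ht.trans (by exact_mod_cast hsub)

/-- a bad point lies on a rich line leaving its plane. -/
lemma bad_point {X : Finset (Submodule ℝ V)} (hX : IsPts ⊥ X) {p Y : Submodule ℝ V}
    (hp : p ∈ X) (hpY : p ≤ Y) (α : ℝ) (hα1 : α < 1) (K : ℕ) (hK : 0 < K)
    (hY : ((X.filter (fun q => q ≤ Y)).card : ℝ) ≤ α * X.card)
    (hbig : (1 - (1 - α) / (4 * K)) * (planesL X p).card <
      (((planesL X p).filter (fun Q => Q ≤ Y)).card : ℝ))
    (hmed : (((X.erase p).filter (fun q => K ≤ lsz X sinc (sln p q) ∧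
      lsz X sinc (sln p q) * K ≤ X.card)).card : ℝ) ≤ (1 - α) / 4 * X.card) :
    ∃ l ∈ richL X sln sinc K, p ≤ l ∧ ¬ l ≤ Y := by
  by_contra hcon
  push Not at hcon
  set Out := X.filter (fun q => ¬ q ≤ Y) with hOut
  set poor := Out.filter (fun q => lsz X sinc (sln p q) < K) with hpoor
  set med := (X.erase p).filter (fun q => K ≤ lsz X sinc (sln p q) ∧
      lsz X sinc (sln p q) * K ≤ X.card) with hmeddef
  have hOutE : Out ⊆ X.erase p := by
    intro q hq
    obtain ⟨h1, h2⟩ := Finset.mem_filter.1 hq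
    refine Finset.mem_erase.2 ⟨?_, h1⟩
    rintro rfl; exact h2 hpY
  have hcov : Out ⊆ poor ∪ med := by
    intro q hq
    rw [Finset.mem_union]
    by_cases h1 : lsz X sinc (sln p q) < K
    · exact Or.inl (Finset.mem_filter.2 ⟨hq, h1⟩)
    right
    refine Finset.mem_filter.2 ⟨hOutE hq, not_lt.1 h1, ?_⟩
    by_contra h2
    have hqE := Finset.mem_erase.1 (hOutE hq)
    have := hcon (sln p q) (Finset.mem_filter.2 ⟨ln_mem hp hqE.2 hqE.1.symm, not_le.1 h2⟩) le_sup_left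
    exact (Finset.mem_filter.1 hq).2 (le_trans le_sup_right this)
  have h1 : (Out.card : ℝ) ≤ poor.card + med.card := by
    exact_mod_cast (Finset.card_le_card hcov).trans (Finset.card_union_le _ _)
  have h2 : (X.card : ℝ) = (X.filter (fun q => q ≤ Y)).card + Out.card := by
    exact_mod_cast (Finset.card_filter_add_card_filter_not (s := X) (fun q => q ≤ Y)).symm
  have h3 : poor.card ≤ K * (poor.image (sln p)).card :=
    poor_le (sub_linsys hX) K p hp poor ((Finset.filter_subset _ _).trans hOutE)
      (fun b hb => (Finset.mem_filter.1 hb).2)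
  have h4 : poor.image (sln p) ⊆ (planesL X p).filter (fun Q => ¬ Q ≤ Y) := by
    intro T hT
    obtain ⟨q, hq, rfl⟩ := Finset.mem_image.1 hT
    have hq' := (Finset.mem_filter.1 hq).1
    refine Finset.mem_filter.2 ⟨image_sub_planes hX hp (Finset.mem_image_of_mem _ (hOutE hq')), ?_⟩
    intro h; exact (Finset.mem_filter.1 hq').2 (le_trans le_sup_right h)
  have h5 : ((planesL X p).card : ℝ) = ((planesL X p).filter (fun Q => Q ≤ Y)).card +
      ((planesL X p).filter (fun Q => ¬ Q ≤ Y)).card := by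
    exact_mod_cast (Finset.card_filter_add_card_filter_not (s := planesL X p) (fun q => q ≤ Y)).symm
  have h6 : ((planesL X p).card : ℝ) ≤ X.card := by exact_mod_cast planesL_card_le X p
  have hK0 : (0 : ℝ) < K := by exact_mod_cast hK
  have h7 : (((planesL X p).filter (fun Q => ¬ Q ≤ Y)).card : ℝ) ≤ (1 - α) / (4 * K) * X.card := by
    have : (1 - α) / (4 * K) * (planesL X p).card ≤ (1 - α) / (4 * K) * X.card := by
      have : 0 ≤ (1 - α) / (4 * K) := div_nonneg (by linarith) (by positivity)
      gcongr
    linarith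
  have h8 : (poor.card : ℝ) ≤ (1 - α) / 4 * X.card := by
    calc (poor.card : ℝ) ≤ K * ((poor.image (sln p)).card : ℝ) := by exact_mod_cast h3
      _ ≤ K * (((planesL X p).filter (fun Q => ¬ Q ≤ Y)).card : ℝ) := by
        have := Finset.card_le_card h4
        gcongr
      _ ≤ K * ((1 - α) / (4 * K) * X.card) := by gcongr
      _ = _ := by field_simp
  have hX0 : (0 : ℝ) < X.card := by exact_mod_cast Finset.card_pos.2 ⟨p, hp⟩
  have h9 : (1 - α) * (X.card : ℝ) ≤ (1 - α) / 2 * X.card := by linarith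
  have := le_of_mul_le_mul_right h9 hX0
  linarith

lemma pairs_line {X : Finset (Submodule ℝ V)} (hX : IsPts ⊥ X) {l : Submodule ℝ V}
    (hl : finrank ℝ l = 2) (t : ℝ) (ht : t ≤ ((planesL X l).card : ℝ)) :
    (X.filter (fun q => q ≤ l)).offDiag ⊆
      X.offDiag.filter (fun z => t ≤ ((planesL X (z.1 ⊔ z.2)).card : ℝ)) := by
  rintro ⟨a, b⟩ hab
  obtain ⟨ha, hb, hne⟩ := Finset.mem_offDiag.1 hab
  obtain ⟨ha, hal⟩ := Finset.mem_filter.1 ha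
  obtain ⟨hb, hbl⟩ := Finset.mem_filter.1 hb
  refine Finset.mem_filter.2 ⟨Finset.mem_offDiag.2 ⟨ha, hb, hne⟩, ?_⟩
  have : a ⊔ b = l := sup_eq_line (hX a ha).1 (hX a ha).2 (hX b hb).1 (hX b hb).2 hne
    (by rw [hl, finrank_bot]) hal hbl
  simpa only [this] using ht

end

section
open Classical

set_option maxHeartbeats 2000000 in
lemma key_lemma (α : ℝ) (hα0 : 0 < α) (hα1 : α < 1) :
    ∃ c : ℝ, 0 < c ∧ ∃ N0 : ℕ, ∀ {V : Type} [AddCommGroup V] [Module ℝ V] [FiniteDimensional ℝ V]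
      (X : Finset (Submodule ℝ V)), IsPts ⊥ X → N0 ≤ X.card →
      (∀ Y : Submodule ℝ V, finrank ℝ Y ≤ 3 →
        ((X.filter (fun q => q ≤ Y)).card : ℝ) ≤ α * X.card) →
      c * (X.card : ℝ) ^ 2 ≤ ((X.offDiag.filter (fun z => c * X.card ≤
        ((planesL X (z.1 ⊔ z.2)).card : ℝ))).card : ℝ) := by
  obtain ⟨δ, hδ0, hδ1, M1, hB1⟩ := beck (1 - α) (by linarith) (by linarith)
  set K : ℕ := ⌈13824 * 16 / (δ * (1 - α))⌉₊ + 2 with hKdef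
  have hK2 : 2 ≤ K := by omega
  have hα' : 0 < 1 - α := by linarith
  have hK0 : (0 : ℝ) < K := by positivity
  have hK1 : (2 : ℝ) ≤ K := by exact_mod_cast hK2
  have hKδ : 13824 / (K : ℝ) ≤ δ * (1 - α) / 16 := by
    have h1 : 13824 * 16 / (δ * (1 - α)) ≤ K := by
      rw [hKdef]; push_cast
      exact (Nat.le_ceil _).trans (by linarith)
    rw [div_le_iff₀ (by positivity)] at h1
    rw [div_le_iff₀ hK0]
    linarith
  set ε : ℝ := (1 - α) / (4 * K) with hε
  have hε0 : 0 < ε := by positivity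
  have hε1 : ε ≤ 1 / 4 := by
    rw [hε, div_le_iff₀ (by positivity)]
    nlinarith
  obtain ⟨c₂, hc0, hc1, M2, hB2⟩ := beck ε hε0 (by linarith)
  set R0 : ℝ := 4608 * (K : ℝ) ^ 3 with hR0
  have hR0pos : 0 < R0 := by positivity
  set c : ℝ := min (c₂ * δ ^ 2 / 2) (min (δ / 2) (δ ^ 2 / (128 * R0 ^ 2))) with hc
  have hcpos : 0 < c := by
    rw [hc]
    refine lt_min (by positivity) (lt_min (by positivity) (by positivity))
  have hcA : c ≤ c₂ * δ ^ 2 / 2 := min_le_left _ _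
  have hcB : c ≤ δ / 2 := (min_le_right _ _).trans (min_le_left _ _)
  have hcC : c ≤ δ ^ 2 / (128 * R0 ^ 2) := (min_le_right _ _).trans (min_le_right _ _)
  refine ⟨c, hcpos, M1 + ⌈M2 / δ⌉₊ + K + ⌈16 * R0 / δ⌉₊ + 1, ?_⟩
  intro V _ _ _ X hX hN hdeg
  set N := X.card with hNdef
  have hN0 : (0 : ℝ) < N := by exact_mod_cast (by omega : 0 < N)
  have hNM2 : (M2 : ℝ) ≤ δ * N := by
    have h1 : (M2 : ℝ) / δ ≤ N := (Nat.le_ceil _).trans (by exact_mod_cast (by omega))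
    rw [div_le_iff₀ hδ0] at h1; linarith
  have hNR : 16 * R0 ≤ δ * N := by
    have h1 : 16 * R0 / δ ≤ N := (Nat.le_ceil _).trans (by exact_mod_cast (by omega))
    rw [div_le_iff₀ hδ0] at h1; linarith
  -- first application of Beck
  set D := X.filter (fun p => δ * N ≤ ((planesL X p).card : ℝ)) with hD
  have hDc : δ * N ≤ (D.card : ℝ) := by
    rcases hB1 (sub_linsys hX) (by omega) with ⟨l, hl, hlt⟩ | h
    · exfalso
      have h1 := hdeg l (by rw [(lset_rank hX hl).1, finrank_bot]; omega)
      have h2 : (lsz X sinc l : ℝ) ≤ α * N := by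
        unfold lsz; convert h1
      rw [← hNdef] at hlt
      linarith
    · rw [← hNdef] at h
      refine h.trans ?_
      have : X.filter (fun a => δ * N ≤ (((X.erase a).image (sln a)).card : ℝ)) ⊆ D := by
        intro p hp
        obtain ⟨h1, h2⟩ := Finset.mem_filter.1 hp
        refine Finset.mem_filter.2 ⟨h1, h2.trans ?_⟩
        exact_mod_cast Finset.card_le_card (image_sub_planes hX h1)
      exact_mod_cast Finset.card_le_card this
  -- second application of Beck
  set Dg := D.filter (fun p => c₂ * (planesL X p).card ≤
      (((planesL X p).filter (fun a => c₂ * (planesL X p).card ≤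
        ((((planesL X p).erase a).image (sln a)).card : ℝ))).card : ℝ)) with hDg
  set Db := D.filter (fun p => ∃ Y : Submodule ℝ V, finrank ℝ Y = 3 ∧ p ≤ Y ∧
      (1 - ε) * (planesL X p).card <
        (((planesL X p).filter (fun Q => Q ≤ Y)).card : ℝ)) with hDb
  have hcov : D ⊆ Dg ∪ Db := by
    intro p hp
    obtain ⟨hpX, hpδ⟩ := Finset.mem_filter.1 hp
    have hM : M2 ≤ (planesL X p).card := by exact_mod_cast hNM2.trans hpδ
    rw [Finset.mem_union]
    rcases hB2 (sub_linsys (planesL_pts hX p)) hM with ⟨l, hl, hlt⟩ | h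
    · right
      have hlr := lset_rank (planesL_pts hX p) hl
      obtain ⟨q, hq, hql⟩ := hlr.2
      refine Finset.mem_filter.2 ⟨hp, l, ?_, (planesL_pts hX p q hq).1.trans hql, ?_⟩
      · rw [hlr.1, pt_rank hX hpX]
      · unfold lsz at hlt; convert hlt
    · left
      exact Finset.mem_filter.2 ⟨hp, h⟩
  have hcard : (D.card : ℝ) ≤ Dg.card + Db.card := by
    exact_mod_cast (Finset.card_le_card hcov).trans (Finset.card_union_le _ _)
  by_cases hcase : δ * N / 2 ≤ (Dg.card : ℝ)
  · -- many good points
    have e0 : (X.offDiag.filter (fun z => c * N ≤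
        ((planesL X (z.1 ⊔ z.2)).card : ℝ))).card = ∑ p ∈ X, ((X.erase p).filter (fun q =>
          c * N ≤ ((planesL X (p ⊔ q)).card : ℝ))).card := by
      convert offDiag_sum X (fun p q => c * N ≤ ((planesL X (p ⊔ q)).card : ℝ))
    rw [e0]
    push_cast
    have h1 : ∀ p ∈ Dg, c₂ * δ * N ≤ (((X.erase p).filter (fun q =>
          c * N ≤ ((planesL X (p ⊔ q)).card : ℝ))).card : ℝ) := by
      intro p hp
      obtain ⟨hpD, hpg⟩ := Finset.mem_filter.1 hp
      obtain ⟨hpX, hpδ⟩ := Finset.mem_filter.1 hpD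
      have h2 : c₂ * δ * N ≤ c₂ * (planesL X p).card := by rw [mul_assoc]; gcongr
      refine h2.trans (hpg.trans ?_)
      have h3 := good_point hX (p := p) (c₂ * (planesL X p).card)
      refine le_trans (Nat.cast_le.2 h3) ?_
      norm_cast
      apply Finset.card_le_card
      intro q hq
      obtain ⟨hq1, hq2⟩ := Finset.mem_filter.1 hq
      refine Finset.mem_filter.2 ⟨hq1, le_trans ?_ hq2⟩
      refine le_trans ?_ h2
      have : c ≤ c₂ * δ := by
        have : c₂ * δ ^ 2 ≤ c₂ * δ := by
          have : δ ^ 2 ≤ δ := by nlinarith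
          gcongr
        have : 0 ≤ c₂ * δ ^ 2 := by positivity
        linarith
      gcongr
    have hsub : Dg ⊆ X := (Finset.filter_subset _ _).trans (Finset.filter_subset _ _)
    calc c * (N : ℝ) ^ 2 ≤ (c₂ * δ ^ 2 / 2) * (N : ℝ) ^ 2 := by gcongr
      _ = (δ * N / 2) * (c₂ * δ * N) := by ring
      _ ≤ Dg.card * (c₂ * δ * N) := by gcongr
      _ = ∑ p ∈ Dg, c₂ * δ * N := by simp
      _ ≤ ∑ p ∈ Dg, (((X.erase p).filter (fun q =>
          c * N ≤ ((planesL X (p ⊔ q)).card : ℝ))).card : ℝ) := Finset.sum_le_sum h1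
      _ ≤ _ := Finset.sum_le_sum_of_subset_of_nonneg hsub (fun _ _ _ => by positivity)
  · -- many bad points
    push Not at hcase
    have hDbc : δ * N / 2 ≤ (Db.card : ℝ) := by linarith
    set md : Submodule ℝ V → ℝ := fun p => (((X.erase p).filter (fun q =>
      K ≤ lsz X sinc (sln p q) ∧ lsz X sinc (sln p q) * K ≤ N)).card : ℝ) with hmd
    have hmdsum : ∑ p ∈ X, md p ≤ δ * (1 - α) / 16 * (N : ℝ) ^ 2 := by
      have h1 := medium_pairs (sub_linsys hX) K hK2
      rw [← hNdef] at h1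
      have e0 : (X.offDiag.filter (fun z => K ≤ lsz X sinc (sln z.1 z.2) ∧
          lsz X sinc (sln z.1 z.2) * K ≤ N)).card = ∑ p ∈ X, ((X.erase p).filter (fun q =>
      K ≤ lsz X sinc (sln p q) ∧ lsz X sinc (sln p q) * K ≤ N)).card := by
        convert offDiag_sum X (fun p q => K ≤ lsz X sinc (sln p q) ∧ lsz X sinc (sln p q) * K ≤ N)
      rw [e0] at h1
      push_cast at h1
      refine h1.trans ?_
      calc 13824 * (N : ℝ) ^ 2 / K = (13824 / K) * (N : ℝ) ^ 2 := by ring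
        _ ≤ _ := by gcongr
    set Bm := X.filter (fun p => (1 - α) / 4 * N < md p) with hBm
    have hBmc : (Bm.card : ℝ) ≤ δ * N / 4 := by
      have h1 : (Bm.card : ℝ) * ((1 - α) / 4 * N) ≤ δ * (1 - α) / 16 * (N : ℝ) ^ 2 := by
        calc (Bm.card : ℝ) * ((1 - α) / 4 * N) = ∑ p ∈ Bm, ((1 - α) / 4 * N) := by simp
          _ ≤ ∑ p ∈ Bm, md p := Finset.sum_le_sum (fun p hp => (Finset.mem_filter.1 hp).2.le)
          _ ≤ ∑ p ∈ X, md p := Finset.sum_le_sum_of_subset_of_nonneg (Finset.filter_subset _ _)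
              (fun _ _ _ => by positivity)
          _ ≤ _ := hmdsum
      have h2 : (Bm.card : ℝ) * ((1 - α) / 4 * N) ≤ (δ * N / 4) * ((1 - α) / 4 * N) := by
        refine h1.trans (le_of_eq (by ring))
      exact le_of_mul_le_mul_right h2 (by positivity)
    set R := (richL X sln sinc K).filter (fun l => δ * N / 2 ≤ ((planesL X l).card : ℝ)) with hR
    have hRc : (R.card : ℝ) ≤ R0 := by
      refine le_trans ?_ (rich_lines (sub_linsys hX) K hK2 (by omega))
      exact_mod_cast Finset.card_le_card (Finset.filter_subset _ _)
    have hrank : ∀ l ∈ R, finrank ℝ l = 2 := by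
      intro l hl
      have := (lset_rank hX (Finset.mem_filter.1 (Finset.mem_filter.1 hl).1).1).1
      rwa [finrank_bot, zero_add] at this
    have hcov2 : Db ⊆ Bm ∪ R.biUnion (fun l => X.filter (fun q => q ≤ l)) := by
      intro p hp
      obtain ⟨hpD, Y, hY3, hpY, hYlt⟩ := Finset.mem_filter.1 hp
      obtain ⟨hpX, hpδ⟩ := Finset.mem_filter.1 hpD
      rw [Finset.mem_union]
      by_cases hm : (1 - α) / 4 * N < md p
      · exact Or.inl (Finset.mem_filter.2 ⟨hpX, hm⟩)
      right
      obtain ⟨l, hl, hpl, hlY⟩ := bad_point hX hpX hpY α hα1 K (by omega) (hdeg Y hY3.le) hYlt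
        (not_lt.1 hm)
      have hlr : finrank ℝ l = 2 := by
        have := (lset_rank hX (Finset.mem_filter.1 hl).1).1
        rwa [finrank_bot, zero_add] at this
      refine Finset.mem_biUnion.2 ⟨l, Finset.mem_filter.2 ⟨hl, ?_⟩, Finset.mem_filter.2 ⟨hpX, hpl⟩⟩
      have h1 := transversal hX hpl (by rw [hlr, pt_rank hX hpX]) hlY
      have h2 : (((planesL X p).filter (fun Q => Q ≤ Y)).card : ℝ) ≤ (planesL X l).card := by
        exact_mod_cast h1
      have h3 : δ * N / 2 ≤ (1 - ε) * (planesL X p).card := by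
        have : (1 / 2 : ℝ) * (δ * N) ≤ (1 - ε) * (planesL X p).card := by
          apply mul_le_mul <;> linarith
        linarith
      linarith
    have hbig : ∃ l ∈ R, δ * N / (8 * R0) ≤ ((X.filter (fun q => q ≤ l)).card : ℝ) := by
      by_contra hcon
      push Not at hcon
      have h1 : (Db.card : ℝ) ≤ Bm.card + ∑ l ∈ R, ((X.filter (fun q => q ≤ l)).card : ℝ) := by
        have := (Finset.card_le_card hcov2).trans (Finset.card_union_le _ _)
        have h2 := this.trans (Nat.add_le_add_left (Finset.card_biUnion_le) _)
        exact_mod_cast h2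
      have h2 : ∑ l ∈ R, ((X.filter (fun q => q ≤ l)).card : ℝ) ≤ R0 * (δ * N / (8 * R0)) := by
        calc _ ≤ ∑ l ∈ R, δ * N / (8 * R0) := Finset.sum_le_sum (fun l hl => (hcon l hl).le)
          _ = R.card * (δ * N / (8 * R0)) := by simp
          _ ≤ _ := by gcongr
      have h3 : R0 * (δ * N / (8 * R0)) = δ * N / 8 := by field_simp
      have : 0 < δ * N := by positivity
      linarith
    obtain ⟨l, hl, hlm⟩ := hbig
    set m := (X.filter (fun q => q ≤ l)).card with hm
    have h1 := Finset.card_le_card (pairs_line hX (hrank l hl) (c * N) (by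
      refine le_trans ?_ (Finset.mem_filter.1 hl).2
      calc c * N ≤ δ / 2 * N := by gcongr
        _ = _ := by ring))
    rw [Finset.offDiag_card, ← hm] at h1
    have h2 : ((m * m - m : ℕ) : ℝ) ≤ ((X.offDiag.filter (fun z => c * N ≤
        ((planesL X (z.1 ⊔ z.2)).card : ℝ))).card : ℝ) := by exact_mod_cast h1
    refine le_trans ?_ h2
    rw [Nat.cast_sub (Nat.le_mul_self m)]
    push_cast
    have hm2 : (2 : ℝ) ≤ m := by
      refine le_trans ?_ hlm
      rw [le_div_iff₀ (by positivity)]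
      linarith
    calc c * (N : ℝ) ^ 2 ≤ δ ^ 2 / (128 * R0 ^ 2) * (N : ℝ) ^ 2 := by gcongr
      _ = (δ * N / (8 * R0)) ^ 2 / 2 := by field_simp; norm_num
      _ ≤ (m : ℝ) ^ 2 / 2 := by gcongr
      _ ≤ _ := by nlinarith
end

section
open Classical
set_option linter.unusedSectionVars false
variable {V : Type} [AddCommGroup V] [Module ℝ V] [FiniteDimensional ℝ V]

/-- hypotheses on a rich degenerate subspace -/
structure RichDeg (α : ℝ) (P : Finset (Submodule ℝ V)) (r : ℕ) (L : Submodule ℝ V) : Prop where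
  rank : finrank ℝ L = 4
  rich : r ≤ (P.filter (fun q => q ≤ L)).card
  deg : ∀ Y : Submodule ℝ V, finrank ℝ Y ≤ 3 →
    (((P.filter (fun q => q ≤ L)).filter (fun q => q ≤ Y)).card : ℝ) ≤
      α * (P.filter (fun q => q ≤ L)).card

lemma extend_flat {α : ℝ} (hα1 : α < 1) {P : Finset (Submodule ℝ V)} (hP : IsPts ⊥ P) {r : ℕ}
    (hr : 1 ≤ r) {L : Submodule ℝ V} (h : RichDeg α P r L) (Y : Submodule ℝ V)
    (hY : finrank ℝ Y ≤ 3) (hYL : Y ≤ L) :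
    ∃ s ∈ P, finrank ℝ (Y ⊔ s : Submodule ℝ V) = finrank ℝ Y + 1 ∧ Y ⊔ s ≤ L := by
  by_contra hcon
  push Not at hcon
  have h1 : (P.filter (fun q => q ≤ L)).filter (fun q => q ≤ Y) = P.filter (fun q => q ≤ L) := by
    refine Finset.filter_true_of_mem ?_
    intro s hs
    obtain ⟨hs, hsL⟩ := Finset.mem_filter.1 hs
    by_contra hsY
    exact hcon s hs (planesL_pts hP Y _ (planesL_mem.2 ⟨s, hs, hsY, rfl⟩)).2 (sup_le hYL hsL)
  have h2 := h.deg Y hY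
  rw [h1] at h2
  have h3 : (1 : ℝ) ≤ (P.filter (fun q => q ≤ L)).card := by exact_mod_cast hr.trans h.rich
  nlinarith

lemma trivial_bound {α : ℝ} (hα1 : α < 1) {P : Finset (Submodule ℝ V)} (hP : IsPts ⊥ P) {r : ℕ}
    (hr : 1 ≤ r) (S : Finset (Submodule ℝ V)) (hS : ∀ L ∈ S, RichDeg α P r L) :
    S.card ≤ P.card ^ 4 := by
  have hsub : S ⊆ (P ×ˢ P ×ˢ P ×ˢ P).image (fun z => ⊥ ⊔ z.1 ⊔ z.2.1 ⊔ z.2.2.1 ⊔ z.2.2.2) := by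
    intro L hL
    have h := hS L hL
    obtain ⟨a, ha, ra, la⟩ := extend_flat hα1 hP hr h ⊥ (by rw [finrank_bot]; omega) bot_le
    rw [finrank_bot] at ra
    obtain ⟨b, hb, rb, lb⟩ := extend_flat hα1 hP hr h _ (by rw [ra]; omega) la
    obtain ⟨c, hc, rc, lc⟩ := extend_flat hα1 hP hr h _ (by omega) lb
    obtain ⟨d, hd, rd, ld⟩ := extend_flat hα1 hP hr h _ (by omega) lc
    refine Finset.mem_image.2 ⟨(a, b, c, d), by simp [ha, hb, hc, hd], ?_⟩
    exact Submodule.eq_of_le_of_finrank_le ld (by rw [h.rank, rd, rc, rb, ra])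
  refine (Finset.card_le_card hsub).trans (Finset.card_image_le.trans (le_of_eq ?_))
  simp only [Finset.card_product]
  ring

lemma pair_bound {P : Finset (Submodule ℝ V)} (hP : IsPts ⊥ P) (S : Finset (Submodule ℝ V))
    (hS : ∀ L ∈ S, finrank ℝ L = 4) (t : ℝ) (ht : 1 < t) (z : Submodule ℝ V × Submodule ℝ V)
    (hz : z ∈ P.offDiag) :
    ((S.filter (fun L => z.1 ≤ L ∧ z.2 ≤ L ∧
      t ≤ ((planesL (P.filter (fun q => q ≤ L)) (z.1 ⊔ z.2)).card : ℝ))).card : ℝ) ≤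
      2304 * ((P.card : ℝ) ^ 2 / t ^ 3 + P.card / t) := by
  obtain ⟨ha, hb, hne⟩ := Finset.mem_offDiag.1 hz
  have hr2 : finrank ℝ (z.1 ⊔ z.2 : Submodule ℝ V) = 2 := by
    have := sup_rank (hP _ ha).1 (hP _ ha).2 (hP _ hb).1 (hP _ hb).2 hne
    rwa [finrank_bot, zero_add] at this
  set W := z.1 ⊔ z.2 with hW
  set k := ⌈t⌉₊ with hk
  have hk2 : 2 ≤ k := by
    have : 1 < k := Nat.lt_ceil.2 (by simpa using ht)
    omega
  have htk : t ≤ k := Nat.le_ceil _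
  set T := S.filter (fun L => z.1 ≤ L ∧ z.2 ≤ L ∧
      t ≤ ((planesL (P.filter (fun q => q ≤ L)) W).card : ℝ)) with hT
  have h1 := st_rel W (planesL P W) (planesL_pts hP W) T (by
      intro L hL; rw [hS L (Finset.mem_filter.1 hL).1, hr2]) k hk2 (by
      intro L hL
      obtain ⟨hLS, h1, h2, h3⟩ := Finset.mem_filter.1 hL
      refine (Nat.ceil_le.2 h3).trans (Finset.card_le_card ?_)
      intro Q hQ
      obtain ⟨s, hs, hsW, rfl⟩ := planesL_mem.1 hQ
      obtain ⟨hs, hsL⟩ := Finset.mem_filter.1 hs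
      exact Finset.mem_filter.2 ⟨planesL_mem.2 ⟨s, hs, hsW, rfl⟩, sup_le (sup_le h1 h2) hsL⟩)
  have h2 : ((planesL P W).card : ℝ) ≤ P.card := by exact_mod_cast planesL_card_le P W
  have ht0 : 0 < t := by linarith
  have hk0 : (0 : ℝ) < k := by linarith
  have h3 : (T.card : ℝ) ≤ 2304 * ((P.card : ℝ) ^ 2 / k ^ 3 + P.card / k) := by
    have e : 2304 * ((P.card : ℝ) ^ 2 / k ^ 3 + P.card / k) =
        2304 * ((P.card : ℝ) ^ 2 + P.card * k ^ 2) / k ^ 3 := by field_simp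
    rw [e, le_div_iff₀ (by positivity)]
    refine h1.trans ?_
    gcongr
  refine h3.trans ?_
  gcongr

end

section
open Classical

lemma linear_main (α : ℝ) (hα0 : 0 < α) (hα1 : α < 1) :
    ∃ C : ℝ, 0 < C ∧ ∀ {V : Type} [AddCommGroup V] [Module ℝ V] [FiniteDimensional ℝ V]
      (P : Finset (Submodule ℝ V)) (r : ℕ), IsPts ⊥ P → 1 ≤ r →
      ∀ S : Finset (Submodule ℝ V), (∀ L ∈ S, RichDeg α P r L) →
      (S.card : ℝ) ≤ C * ((P.card : ℝ) ^ 4 / (r : ℝ) ^ 5 + (P.card : ℝ) ^ 3 / (r : ℝ) ^ 3) := by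
  obtain ⟨c, hc, N0, hkey⟩ := key_lemma α hα0 hα1
  set r0 : ℕ := N0 + ⌈1 / c⌉₊ + 1 with hr0
  set C2 : ℝ := 2304 * (1 / c ^ 4 + 1 / c ^ 2) with hC2
  have hC2p : 0 < C2 := by positivity
  have hr0p : (0 : ℝ) < r0 := by rw [hr0]; positivity
  refine ⟨(r0 : ℝ) ^ 5 + C2, by positivity, ?_⟩
  intro V _ _ _ P r hP hr S hS
  set n : ℝ := (P.card : ℝ) with hn
  have hn0 : 0 ≤ n := by positivity
  have hrp : (0 : ℝ) < r := by exact_mod_cast hr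
  set A := n ^ 4 / (r : ℝ) ^ 5 with hA
  set B := n ^ 3 / (r : ℝ) ^ 3 with hB
  have hA0 : 0 ≤ A := by positivity
  have hB0 : 0 ≤ B := by positivity
  by_cases hcase : r < r0
  · have h1 : (S.card : ℝ) ≤ n ^ 4 := by
      rw [hn]; exact_mod_cast trivial_bound hα1 hP hr S hS
    have h2 : n ^ 4 ≤ (r0 : ℝ) ^ 5 * A := by
      rw [hA, ← mul_div_assoc, le_div_iff₀ (by positivity), mul_comm]
      have : (r : ℝ) ≤ r0 := by exact_mod_cast hcase.le
      gcongr
    have h3 : 0 ≤ (r0 : ℝ) ^ 5 * B := by positivity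
    have h4 : 0 ≤ C2 * (A + B) := by positivity
    nlinarith
  · push Not at hcase
    have hcr : 1 < c * r := by
      have h1 : 1 / c < r := lt_of_le_of_lt (Nat.le_ceil _) (by exact_mod_cast (by omega))
      rw [div_lt_iff₀ hc] at h1; linarith
    set rel : Submodule ℝ V → Submodule ℝ V × Submodule ℝ V → Prop := fun L z =>
      z.1 ≤ L ∧ z.2 ≤ L ∧ c * r ≤ ((planesL (P.filter (fun q => q ≤ L)) (z.1 ⊔ z.2)).card : ℝ)
      with hrel
    have hdc := Finset.sum_card_bipartiteAbove_eq_sum_card_bipartiteBelow (s := S) (t := P.offDiag) rel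
    have hlow : ∀ L ∈ S, c * (r : ℝ) ^ 2 ≤ ((Finset.bipartiteAbove rel P.offDiag L).card : ℝ) := by
      intro L hL
      have h := hS L hL
      set X := P.filter (fun q => q ≤ L) with hX
      have hXP : IsPts ⊥ X := fun q hq => hP q (Finset.mem_filter.1 hq).1
      have h1 := hkey X hXP (le_trans (by omega) (show r ≤ X.card from h.rich)) h.deg
      have hrX : (r : ℝ) ≤ X.card := by exact_mod_cast h.rich
      have h2 : c * (r : ℝ) ^ 2 ≤ c * (X.card : ℝ) ^ 2 := by gcongr
      refine h2.trans (h1.trans ?_)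
      norm_cast
      apply Finset.card_le_card
      intro z hz
      obtain ⟨hz1, hz2⟩ := Finset.mem_filter.1 hz
      obtain ⟨ha, hb, hne⟩ := Finset.mem_offDiag.1 hz1
      obtain ⟨ha, haL⟩ := Finset.mem_filter.1 ha
      obtain ⟨hb, hbL⟩ := Finset.mem_filter.1 hb
      refine Finset.mem_filter.2 ⟨Finset.mem_offDiag.2 ⟨ha, hb, hne⟩, haL, hbL, le_trans ?_ hz2⟩
      gcongr
    have hup : ∀ z ∈ P.offDiag, ((Finset.bipartiteBelow rel S z).card : ℝ) ≤
        2304 * (n ^ 2 / (c * r) ^ 3 + n / (c * r)) := by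
      intro z hz
      have := pair_bound hP S (fun L hL => (hS L hL).rank) (c * r) hcr z hz
      refine le_trans (le_of_eq ?_) this
      unfold Finset.bipartiteBelow
      congr!
    have h1 : (S.card : ℝ) * (c * (r : ℝ) ^ 2) ≤
        n ^ 2 * (2304 * (n ^ 2 / (c * r) ^ 3 + n / (c * r))) := by
      calc (S.card : ℝ) * (c * (r : ℝ) ^ 2) = ∑ L ∈ S, c * (r : ℝ) ^ 2 := by simp
        _ ≤ ∑ L ∈ S, ((Finset.bipartiteAbove rel P.offDiag L).card : ℝ) := Finset.sum_le_sum hlow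
        _ = ∑ z ∈ P.offDiag, ((Finset.bipartiteBelow rel S z).card : ℝ) := by exact_mod_cast hdc
        _ ≤ ∑ z ∈ P.offDiag, 2304 * (n ^ 2 / (c * r) ^ 3 + n / (c * r)) := Finset.sum_le_sum hup
        _ = P.offDiag.card * (2304 * (n ^ 2 / (c * r) ^ 3 + n / (c * r))) := by
          rw [Finset.sum_const, nsmul_eq_mul]
        _ ≤ _ := by
          have h2 : P.offDiag.card ≤ P.card ^ 2 := by
            rw [Finset.offDiag_card, sq]; exact Nat.sub_le _ _
          have h3 : (P.offDiag.card : ℝ) ≤ n ^ 2 := by rw [hn]; exact_mod_cast h2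
          gcongr
    have h2 : (S.card : ℝ) ≤ 2304 * (1 / c ^ 4 * A + 1 / c ^ 2 * B) := by
      refine le_of_mul_le_mul_right (h1.trans (le_of_eq ?_)) (by positivity : 0 < c * (r : ℝ) ^ 2)
      rw [hA, hB]
      field_simp
    have h3 : 2304 * (1 / c ^ 4 * A + 1 / c ^ 2 * B) ≤ C2 * (A + B) := by
      have e1 : 0 ≤ 1 / c ^ 4 * B := by positivity
      have e2 : 0 ≤ 1 / c ^ 2 * A := by positivity
      rw [hC2]; nlinarith
    have h4 : 0 ≤ (r0 : ℝ) ^ 5 * (A + B) := by positivity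
    linarith
end

section
open Classical

abbrev HV (d : ℕ) : Type := (Fin d → ℝ) × ℝ

noncomputable def hpt {d : ℕ} (x : Fin d → ℝ) : Submodule ℝ (HV d) := Submodule.span ℝ {((x, 1) : HV d)}

noncomputable def cone {d : ℕ} (D : Submodule ℝ (Fin d → ℝ)) (p : Fin d → ℝ) : Submodule ℝ (HV d) :=
  D.map (LinearMap.inl ℝ (Fin d → ℝ) ℝ) ⊔ hpt p

lemma hpt_le {d : ℕ} {x : Fin d → ℝ} {L : Submodule ℝ (HV d)} : hpt x ≤ L ↔ ((x, 1) : HV d) ∈ L := by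
  unfold hpt; rw [Submodule.span_singleton_le_iff_mem]

lemma hpt_rank {d : ℕ} (x : Fin d → ℝ) : finrank ℝ (hpt x) = 1 :=
  finrank_span_singleton (by
    intro h
    have := congrArg Prod.snd h
    simp at this)

lemma hpt_inj {d : ℕ} : Function.Injective (hpt (d := d)) := by
  intro x y h
  have h1 := hpt_le.1 h.le
  unfold hpt at h1
  obtain ⟨a, ha⟩ := Submodule.mem_span_singleton.1 h1
  have h2 := congrArg Prod.snd ha
  have h3 := congrArg Prod.fst ha
  simp at h2 h3
  rw [h2, one_smul] at h3
  exact h3.symm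

lemma cone_mem {d : ℕ} {D : Submodule ℝ (Fin d → ℝ)} {p : Fin d → ℝ} {v : HV d} :
    v ∈ cone D p ↔ v.1 - v.2 • p ∈ D := by
  unfold cone hpt
  rw [Submodule.mem_sup]
  constructor
  · rintro ⟨y, hy, z, hz, rfl⟩
    obtain ⟨w, hw, rfl⟩ := Submodule.mem_map.1 hy
    obtain ⟨a, rfl⟩ := Submodule.mem_span_singleton.1 hz
    simpa using hw
  · intro h
    refine ⟨(v.1 - v.2 • p, 0), Submodule.mem_map.2 ⟨_, h, rfl⟩, v.2 • (p, 1),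
      Submodule.mem_span_singleton.2 ⟨_, rfl⟩, ?_⟩
    ext <;> simp

lemma add_point_rank {V : Type} [AddCommGroup V] [Module ℝ V] [FiniteDimensional ℝ V]
    (A s : Submodule ℝ V) (hs : finrank ℝ s = 1) (h : ¬ s ≤ A) :
    finrank ℝ (A ⊔ s : Submodule ℝ V) = finrank ℝ A + 1 := by
  have hX : IsPts ⊥ ({s} : Finset (Submodule ℝ V)) := by
    intro q hq
    rw [Finset.mem_singleton.1 hq, finrank_bot, hs]
    exact ⟨bot_le, rfl⟩
  exact (planesL_pts hX A _ (planesL_mem.2 ⟨s, by simp, h, rfl⟩)).2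

lemma cone_rank {d : ℕ} (D : Submodule ℝ (Fin d → ℝ)) (p : Fin d → ℝ) :
    finrank ℝ (cone D p) = finrank ℝ D + 1 := by
  unfold cone
  have h1 : finrank ℝ (D.map (LinearMap.inl ℝ (Fin d → ℝ) ℝ)) = finrank ℝ D :=
    (Submodule.equivMapOfInjective _ LinearMap.inl_injective D).finrank_eq.symm
  rw [add_point_rank _ _ (hpt_rank p), h1]
  rw [hpt_le]
  intro h
  obtain ⟨w, hw, e⟩ := Submodule.mem_map.1 h
  have := congrArg Prod.snd e
  simp at this

lemma cone_comap {d : ℕ} {Y : Submodule ℝ (HV d)} {x : Fin d → ℝ} (hx : ((x, 1) : HV d) ∈ Y) :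
    cone (Y.comap (LinearMap.inl ℝ (Fin d → ℝ) ℝ)) x = Y := by
  ext v
  rw [cone_mem, Submodule.mem_comap]
  have e : LinearMap.inl ℝ (Fin d → ℝ) ℝ (v.1 - v.2 • x) = v - v.2 • ((x, 1) : HV d) := by
    ext <;> simp
  rw [e, Submodule.sub_mem_iff_left _ (Y.smul_mem _ hx)]

lemma extend_three {V : Type} [AddCommGroup V] [Module ℝ V] [FiniteDimensional ℝ V]
    (L : Submodule ℝ V) (hL : finrank ℝ L = 4) (k : ℕ) : ∀ A : Submodule ℝ V, A ≤ L →
    finrank ℝ A + k = 3 → ∃ Y, A ≤ Y ∧ Y ≤ L ∧ finrank ℝ Y = 3 := by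
  induction k with
  | zero => intro A hA h; exact ⟨A, le_rfl, hA, h⟩
  | succ k ih =>
    intro A hA h
    have hlt : A < L := lt_of_le_of_ne hA (by rintro rfl; omega)
    obtain ⟨v, hv, hvA⟩ := SetLike.exists_of_lt hlt
    have hv0 : v ≠ 0 := by rintro rfl; exact hvA A.zero_mem
    have h1 := add_point_rank A (Submodule.span ℝ {v}) (finrank_span_singleton hv0) (by
      rwa [Submodule.span_singleton_le_iff_mem])
    obtain ⟨Y, hY1, hY2, hY3⟩ := ih (A ⊔ Submodule.span ℝ {v})
      (sup_le hA (by rwa [Submodule.span_singleton_le_iff_mem])) (by omega)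
    exact ⟨Y, le_sup_left.trans hY1, hY2, hY3⟩

noncomputable def hat {d : ℕ} (A : AffineSubspace ℝ (Fin d → ℝ)) : Submodule ℝ (HV d) :=
  if h : (A : Set (Fin d → ℝ)).Nonempty then cone A.direction h.some else ⊥

lemma hat_mem {d : ℕ} {A : AffineSubspace ℝ (Fin d → ℝ)} (h : (A : Set (Fin d → ℝ)).Nonempty)
    (x : Fin d → ℝ) : ((x, 1) : HV d) ∈ hat A ↔ x ∈ A := by
  unfold hat
  rw [dif_pos h, cone_mem]
  simp only [one_smul]
  rw [← vsub_eq_sub]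
  exact AffineSubspace.vsub_right_mem_direction_iff_mem h.some_mem x

lemma hat_rank {d : ℕ} {A : AffineSubspace ℝ (Fin d → ℝ)} (h : (A : Set (Fin d → ℝ)).Nonempty) :
    finrank ℝ (hat A) = finrank ℝ A.direction + 1 := by
  unfold hat
  rw [dif_pos h, cone_rank]

lemma count_eq {d : ℕ} (P : Finset (Fin d → ℝ)) (A : Set (Fin d → ℝ))
    (L : Submodule ℝ (HV d)) (h : ∀ x ∈ P, ((x, 1) : HV d) ∈ L ↔ x ∈ A) :
    ((P : Set (Fin d → ℝ)) ∩ A).ncard = ((P.image hpt).filter (fun q => q ≤ L)).card := by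
  have e1 : (P : Set (Fin d → ℝ)) ∩ A = ((P.filter (fun x => hpt x ≤ L) : Finset (Fin d → ℝ)) : Set _) := by
    ext x
    simp only [Set.mem_inter_iff, Finset.coe_filter, Finset.mem_coe]
    constructor
    · rintro ⟨h1, h2⟩; exact ⟨h1, hpt_le.2 ((h x h1).2 h2)⟩
    · rintro ⟨h1, h2⟩; exact ⟨h1, (h x h1).1 (hpt_le.1 h2)⟩
  rw [e1, Set.ncard_coe_finset, Finset.filter_image, Finset.card_image_of_injective _ hpt_inj]

end

/-- For any `α` with `0 < α < 1`, the number of `α`-degenerate, `r`-rich 3-flats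
determined by a set of `n` points in real space is `O_α(n⁴r⁻⁵ + n³r⁻³)`. -/
theorem stmt_11 (α : ℝ) (hα0 : 0 < α) (hα1 : α < 1) :
    ∃ C : ℝ, 0 < C ∧
      ∀ (d : ℕ) (P : Finset (Fin d → ℝ)) (r : ℕ), 1 ≤ r →
        ∀ S : Finset (AffineSubspace ℝ (Fin d → ℝ)),
          (∀ Λ ∈ S,
            finrank ℝ Λ.direction = 3 ∧
            (r : ℝ) ≤ (((P : Set (Fin d → ℝ)) ∩ (Λ : Set (Fin d → ℝ))).ncard : ℝ) ∧
            ∀ Λ' : AffineSubspace ℝ (Fin d → ℝ), Λ' ≤ Λ →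
              finrank ℝ Λ'.direction = 2 →
              (((P : Set (Fin d → ℝ)) ∩ (Λ' : Set (Fin d → ℝ))).ncard : ℝ) ≤
                α * (((P : Set (Fin d → ℝ)) ∩ (Λ : Set (Fin d → ℝ))).ncard : ℝ)) →
          (S.card : ℝ) ≤
            C * ((P.card : ℝ) ^ 4 / (r : ℝ) ^ 5 + (P.card : ℝ) ^ 3 / (r : ℝ) ^ 3) := by
  classical
  obtain ⟨C, hC, hmain⟩ := linear_main α hα0 hα1
  refine ⟨C, hC, ?_⟩
  intro d P r hr S hS
  have hne : ∀ A ∈ S, (A : Set (Fin d → ℝ)).Nonempty := by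
    intro A hA
    by_contra h
    rw [Set.not_nonempty_iff_eq_empty] at h
    have h1 := (hS A hA).2.1
    rw [h] at h1
    simp at h1
    omega
  have hP : IsPts ⊥ (P.image hpt) := by
    intro q hq
    obtain ⟨x, hx, rfl⟩ := Finset.mem_image.1 hq
    rw [finrank_bot, hpt_rank]
    exact ⟨bot_le, rfl⟩
  have hinj : Set.InjOn (hat (d := d)) S := by
    intro A hA B hB h
    ext x
    rw [← hat_mem (hne A hA), h, hat_mem (hne B hB)]
  have hcS : (S.image hat).card = S.card := Finset.card_image_of_injOn hinj
  have hcP : (P.image hpt).card = P.card := Finset.card_image_of_injective _ hpt_inj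
  have := hmain (P.image hpt) r hP hr (S.image hat) (by
    intro L hL
    obtain ⟨A, hA, rfl⟩ := Finset.mem_image.1 hL
    have hAne := hne A hA
    obtain ⟨h3, hrich, hdeg⟩ := hS A hA
    have hcA := count_eq P A (hat A) (fun x _ => hat_mem hAne x)
    rw [hcA] at hrich hdeg
    have hrk : finrank ℝ (hat A) = 4 := by rw [hat_rank hAne, h3]
    refine ⟨hrk, ?_, ?_⟩
    · convert (Nat.cast_le (α := ℝ)).1 hrich
    · intro Y hY
      obtain ⟨Y', h1, h2, hY3⟩ := extend_three (hat A) hrk (3 - finrank ℝ (Y ⊓ hat A : Submodule ℝ (HV d)))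
        (Y ⊓ hat A) inf_le_right (by
          have := Submodule.finrank_mono (inf_le_left : Y ⊓ hat A ≤ Y)
          omega)
      have hle : (((P.image hpt).filter (fun q => q ≤ hat A)).filter (fun q => q ≤ Y)).card ≤
          ((P.image hpt).filter (fun q => q ≤ Y')).card := by
        apply Finset.card_le_card
        intro q hq
        obtain ⟨hq1, hq2⟩ := Finset.mem_filter.1 hq
        obtain ⟨hq1, hq3⟩ := Finset.mem_filter.1 hq1
        exact Finset.mem_filter.2 ⟨hq1, (le_inf hq2 hq3).trans h1⟩
      have hfin : (((P.image hpt).filter (fun q => q ≤ Y')).card : ℝ) ≤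
          α * ((P.image hpt).filter (fun q => q ≤ hat A)).card := by
        by_cases hex : ∃ x ∈ P, ((x, 1) : HV d) ∈ Y'
        · obtain ⟨x, hx, hxY⟩ := hex
          set D := Y'.comap (LinearMap.inl ℝ (Fin d → ℝ) ℝ) with hD
          have hmem : ∀ y : Fin d → ℝ, ((y, 1) : HV d) ∈ Y' ↔ y ∈ AffineSubspace.mk' x D := by
            intro y
            rw [← cone_comap hxY, cone_mem, AffineSubspace.mem_mk']
            simp [hD]
          have hB := hdeg (AffineSubspace.mk' x D) (by
            intro y hy
            exact (hat_mem hAne y).1 (h2 ((hmem y).2 hy))) (by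
            rw [AffineSubspace.direction_mk']
            have := cone_rank D x
            have h5 : cone D x = Y' := cone_comap hxY
            rw [h5, hY3] at this
            omega)
          rw [count_eq P _ Y' (fun y _ => hmem y)] at hB
          convert hB
        · have : (P.image hpt).filter (fun q => q ≤ Y') = ∅ := by
            refine Finset.filter_false_of_mem ?_
            intro q hq hqY
            obtain ⟨x, hx, rfl⟩ := Finset.mem_image.1 hq
            exact hex ⟨x, hx, hpt_le.1 hqY⟩
          rw [this]
          simp only [Finset.card_empty, Nat.cast_zero]
          positivity
      have hle' : ((((P.image hpt).filter (fun q => q ≤ hat A)).filter (fun q => q ≤ Y)).card : ℝ) ≤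
          ((P.image hpt).filter (fun q => q ≤ Y')).card := by exact_mod_cast hle
      convert hle'.trans hfin)
  have e1 : ((S.image hat).card : ℝ) = S.card := by exact_mod_cast hcS
  have e2 : ((P.image hpt).card : ℝ) = P.card := by exact_mod_cast hcP
  rw [← e1, ← e2]
  convert this
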